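/- arXiv:1710.09115 — 2 statements merged into one kernel-verified Lean document; each statement's English description precedes it below -/
import Mathlib

section
/- Assume s_n > 0 and that there exist constants β and δ such that E(|X_k|³ | F_{k-1}) ≤ min(β, δσ_k²) almost surely for all 1 ≤ k ≤ n. Then d_W(L(S_n/s_n), N(0,1)) ≤ 1.5·(E|V_n²/s_n² − 1|)^{1/2} + 3n·max(1.6β^{1/3}, δ)·(s_n²/n + 1.4β^{2/3})·(1 + log n)/s_n³ + 2/√n. -/
open MeasureTheory ProbabilityTheory Real Finset

/-- The standard normal distribution. -/
noncomputable abbrev stdNormal : Measure ℝ := gaussianReal 0 1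

lemma abs_le_abs_add_mul_exp {g : ℝ → ℝ} {L : NNReal} (hg : LipschitzWith L g) (c z : ℝ) :
    |g (c + z)| ≤ (|g c| + L) * exp |z| := by
  have h1 : |g (c + z) - g c| ≤ L * |z| := by
    simpa [Real.dist_eq] using hg.dist_le_mul (c + z) c
  have h2 : |z| + 1 ≤ exp |z| := add_one_le_exp _
  have h3 : |g (c + z)| ≤ |g (c + z) - g c| + |g c| := by
    simpa using abs_add_le (g (c + z) - g c) (g c)
  have hL : (0 : ℝ) ≤ L := L.2
  nlinarith [abs_nonneg (g c), abs_nonneg z]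

lemma integrable_exp_mul_abs_stdNormal (a : ℝ) :
    Integrable (fun z => exp (a * |z|)) stdNormal :=
  integrable_exp_mul_abs (X := fun z => z) (integrable_exp_mul_gaussianReal a)
    (integrable_exp_mul_gaussianReal (-a))

lemma integrable_shift_mul_stdNormal {g q : ℝ → ℝ} {L : NNReal} (hg : LipschitzWith L g)
    (hq : Continuous q) {K : ℝ} (hqK : ∀ z, |q z| ≤ K * exp (4 * |z|)) (c : ℝ) :
    Integrable (fun z => g (c + z) * q z) stdNormal := by
  refine ((integrable_exp_mul_abs_stdNormal 5).const_mul ((|g c| + L) * K)).mono' ?_ ?_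
  · have := hg.continuous
    exact Continuous.aestronglyMeasurable (by fun_prop)
  · filter_upwards with z
    rw [norm_mul, Real.norm_eq_abs, Real.norm_eq_abs]
    calc |g (c + z)| * |q z| ≤ ((|g c| + L) * exp |z|) * (K * exp (4 * |z|)) := by
          gcongr
          · exact abs_le_abs_add_mul_exp hg c z
          · exact hqK z
      _ = (|g c| + L) * K * exp (5 * |z|) := by
          rw [show 5 * |z| = |z| + 4 * |z| by ring, exp_add]; ring

lemma gaussianPDFReal_zero_one (z : ℝ) :
    gaussianPDFReal 0 1 z = (√(2 * π))⁻¹ * exp (-(z ^ 2 / 2)) := by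
  simp [gaussianPDFReal, neg_div]

lemma gaussianPDFReal_mul_exp_le (z : ℝ) :
    gaussianPDFReal 0 1 z * exp (4 * |z|) ≤ exp 18 * exp (-(2 * |z|)) := by
  have h1 : (√(2 * π))⁻¹ ≤ 1 := by
    apply inv_le_one_of_one_le₀
    rw [Real.one_le_sqrt]
    nlinarith [pi_gt_three]
  rw [gaussianPDFReal_zero_one, mul_assoc, ← exp_add, ← exp_add]
  calc _ ≤ 1 * exp (-(z ^ 2 / 2) + 4 * |z|) := by gcongr
    _ ≤ _ := by
      rw [one_mul, exp_le_exp]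
      nlinarith [sq_abs z, sq_nonneg (|z| - 6)]

lemma hasDerivAt_gaussianPDFReal_zero_one (z : ℝ) :
    HasDerivAt (gaussianPDFReal 0 1) (-z * gaussianPDFReal 0 1 z) z := by
  have : gaussianPDFReal 0 1 = fun z => (√(2 * π))⁻¹ * exp (-(z ^ 2 / 2)) :=
    funext gaussianPDFReal_zero_one
  rw [this]
  have h1 : HasDerivAt (fun z : ℝ => -(z ^ 2 / 2)) (-z) z := by
    exact ((hasDerivAt_pow 2 z).div_const 2).fun_neg.congr_deriv (by simp)
  exact (h1.exp.const_mul (√(2 * π))⁻¹).congr_deriv (by ring)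

lemma integrable_exp_neg_abs_sub (c : ℝ) : Integrable (fun v : ℝ => exp (-|v - c|)) := by
  have h0 : Integrable (fun v : ℝ => exp (-|v|)) := by
    have h1 : IntegrableOn (fun v : ℝ => exp (-|v|)) (Set.Ioi 0) :=
      (integrableOn_exp_neg_Ioi 0).congr_fun
        (fun v hv => by simp [abs_of_pos (Set.mem_Ioi.1 hv)]) measurableSet_Ioi
    have h2 : IntegrableOn (fun v : ℝ => exp (-|v|)) (Set.Iic 0) :=
      (integrableOn_exp_Iic 0).congr_fun
        (fun v hv => by simp [abs_of_nonpos (Set.mem_Iic.1 hv)]) measurableSet_Iic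
    rw [← integrableOn_univ, ← Set.Iic_union_Ioi (a := (0 : ℝ))]
    exact h2.union h1
  exact h0.comp_sub_right c

/-- Gaussian integration by parts: shifting the argument of `g` can be differentiated by
differentiating the weight `q` times the Gaussian density. -/
lemma hasDerivAt_integral_shift_mul_stdNormal {g q q' : ℝ → ℝ} {L : NNReal}
    (hg : LipschitzWith L g) (hq : ∀ z, HasDerivAt q (q' z) z) (hq' : Continuous q') {K : ℝ}
    (hqK : ∀ z, |q z| ≤ K * exp (4 * |z|))
    (hqK' : ∀ z, |z * q z - q' z| ≤ K * exp (4 * |z|)) (c : ℝ) :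
    HasDerivAt (fun c => ∫ z, g (c + z) * q z ∂stdNormal)
      (∫ z, g (c + z) * (z * q z - q' z) ∂stdNormal) c := by
  have hgc := hg.continuous
  have hqc : Continuous q := continuous_iff_continuousAt.2 fun z => (hq z).continuousAt
  have hφc : Continuous (gaussianPDFReal 0 1) :=
    continuous_iff_continuousAt.2 fun z => (hasDerivAt_gaussianPDFReal_zero_one z).continuousAt
  have hK : 0 ≤ K := by simpa using (abs_nonneg _).trans (hqK 0)
  have key (p : ℝ → ℝ) (c : ℝ) : ∫ z, g (c + z) * p z ∂stdNormal
      = ∫ v, g v * (p (v - c) * gaussianPDFReal 0 1 (v - c)) := by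
    rw [integral_gaussianReal_eq_integral_smul one_ne_zero,
      ← integral_sub_right_eq_self _ c]
    congr 1 with v
    simp
    ring
  simp_rw [key]
  set D : ℝ → ℝ := fun z => z * q z - q' z with hD
  have hDc : Continuous D := by fun_prop
  have hbd (p : ℝ → ℝ) (hp : ∀ z, |p z| ≤ K * exp (4 * |z|)) (c' : ℝ) (hc' : |c' - c| < 1) (v : ℝ) :
      ‖g v * (p (v - c') * gaussianPDFReal 0 1 (v - c'))‖
        ≤ (|g c| + L) * K * exp 20 * exp (-|v - c|) := by
    have h1 := abs_le_abs_add_mul_exp hg c (v - c)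
    rw [add_sub_cancel] at h1
    have h2 : |p (v - c')| * gaussianPDFReal 0 1 (v - c')
        ≤ K * (exp 20 * exp (-(2 * |v - c|))) := by
      calc _ ≤ K * exp (4 * |v - c'|) * gaussianPDFReal 0 1 (v - c') := by
            gcongr
            · exact gaussianPDFReal_nonneg _ _ _
            · exact hp _
        _ = K * (gaussianPDFReal 0 1 (v - c') * exp (4 * |v - c'|)) := by ring
        _ ≤ K * (exp 18 * exp (-(2 * |v - c'|))) := by
            gcongr K * ?_
            exact gaussianPDFReal_mul_exp_le _
        _ ≤ _ := by
            gcongr K * ?_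
            rw [← exp_add, ← exp_add, exp_le_exp]
            have : |v - c| ≤ |v - c'| + |c' - c| := abs_sub_le _ _ _
            linarith
    rw [norm_mul, norm_mul, Real.norm_eq_abs, Real.norm_eq_abs, Real.norm_eq_abs,
      abs_of_nonneg (gaussianPDFReal_nonneg _ _ _)]
    calc _ ≤ ((|g c| + L) * exp |v - c|) * (K * (exp 20 * exp (-(2 * |v - c|)))) := by
          gcongr
          exact mul_nonneg (abs_nonneg _) (gaussianPDFReal_nonneg _ _ _)
      _ = (|g c| + L) * K * exp 20 * (exp |v - c| * exp (-(2 * |v - c|))) := by ring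
      _ = _ := by rw [← exp_add]; ring_nf
  have hbi := (integrable_exp_neg_abs_sub c).const_mul ((|g c| + L) * K * exp 20)
  refine (hasDerivAt_integral_of_dominated_loc_of_deriv_le (Metric.ball_mem_nhds c one_pos)
    (F := fun c v => g v * (q (v - c) * gaussianPDFReal 0 1 (v - c)))
    (F' := fun c v => g v * (D (v - c) * gaussianPDFReal 0 1 (v - c)))
    (bound := fun v => (|g c| + L) * K * exp 20 * exp (-|v - c|)) ?_ ?_ ?_ ?_ hbi ?_).2
  · exact Filter.Eventually.of_forall fun c' => Continuous.aestronglyMeasurable (by fun_prop)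
  · exact hbi.mono' (Continuous.aestronglyMeasurable (by fun_prop))
      (Filter.Eventually.of_forall fun v => hbd q hqK c (by simp) v)
  · exact Continuous.aestronglyMeasurable (by fun_prop)
  · exact Filter.Eventually.of_forall fun v c' hc' =>
      hbd D hqK' c' (by simpa [Real.dist_eq] using hc') v
  · refine Filter.Eventually.of_forall fun v c' _ => ?_
    have h1 : HasDerivAt (fun c => v - c) (-1) c' := by
      simpa using (hasDerivAt_id c').const_sub v
    have h2 := ((((hq (v - c')).mul
      (hasDerivAt_gaussianPDFReal_zero_one (v - c'))).comp c' h1).const_mul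
      (g v))
    refine h2.congr_deriv ?_
    simp only [hD]
    ring

/-- The Gaussian average of `z ↦ h (x + r z) q z`. -/
noncomputable def gaussSmooth (h q : ℝ → ℝ) (r x : ℝ) : ℝ :=
  ∫ z, h (x + r * z) * q z ∂stdNormal

lemma hasDerivAt_gaussSmooth {h q q' : ℝ → ℝ} (hh : LipschitzWith 1 h)
    (hq : ∀ z, HasDerivAt q (q' z) z) (hq' : Continuous q') {K : ℝ}
    (hqK : ∀ z, |q z| ≤ K * exp (4 * |z|))
    (hqK' : ∀ z, |z * q z - q' z| ≤ K * exp (4 * |z|)) {r : ℝ} (hr : 0 < r) (x : ℝ) :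
    HasDerivAt (gaussSmooth h q r) (r⁻¹ * gaussSmooth h (fun z => z * q z - q' z) r x) x := by
  have hg : LipschitzWith (1 * ‖r‖₊) fun z => h (r * z) := hh.comp (lipschitzWith_smul r)
  have h1 := hasDerivAt_integral_shift_mul_stdNormal hg hq hq' hqK hqK' (x / r)
  have h2 := h1.comp x ((hasDerivAt_id' x).div_const r)
  have key (p : ℝ → ℝ) (x : ℝ) :
      ∫ z, h (r * (x / r + z)) * p z ∂stdNormal = gaussSmooth h p r x := by
    have (z : ℝ) : r * (x / r + z) = x + r * z := by field_simp
    simp_rw [this]; rfl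
  simp only [Function.comp_def, key] at h2
  exact h2.congr_deriv (by rw [one_div, mul_comm])

lemma abs_pow_le_exp_four_mul (z : ℝ) :
    |(1 : ℝ)| ≤ 4 * exp (4 * |z|) ∧ |z| ≤ 4 * exp (4 * |z|) ∧ |z ^ 2 - 1| ≤ 4 * exp (4 * |z|) ∧
      |z ^ 3 - 3 * z| ≤ 4 * exp (4 * |z|) := by
  have h0 := abs_nonneg z
  have h1 : |z| + 1 ≤ exp |z| := add_one_le_exp _
  have h4 : exp (4 * |z|) = exp |z| ^ 4 := by rw [← exp_nat_mul]; norm_num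
  rw [h4]
  set y := exp |z|
  have hz : z ^ 2 = |z| ^ 2 := (sq_abs z).symm
  have hy : |z| ≤ y := by linarith
  have hy1 : 1 ≤ y := by linarith
  have e1 : y ≤ y ^ 4 := le_self_pow₀ hy1 (by norm_num)
  have e2 : y ^ 2 ≤ y ^ 4 := pow_le_pow_right₀ hy1 (by norm_num)
  have e3 : y ^ 3 ≤ y ^ 4 := pow_le_pow_right₀ hy1 (by norm_num)
  have f2 : |z| ^ 2 ≤ y ^ 2 := pow_le_pow_left₀ h0 hy 2
  have f3 : |z| ^ 3 ≤ y ^ 3 := pow_le_pow_left₀ h0 hy 3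
  refine ⟨by rw [abs_one]; linarith, by linarith, ?_, ?_⟩
  · rw [abs_le]
    constructor <;> nlinarith [sq_nonneg |z|]
  · calc |z ^ 3 - 3 * z| ≤ |z ^ 3| + |3 * z| := abs_sub _ _
      _ = |z| ^ 3 + 3 * |z| := by rw [abs_pow, abs_mul]; norm_num
      _ ≤ _ := by linarith

lemma hasDerivAt_gaussSmooth_one {h : ℝ → ℝ} (hh : LipschitzWith 1 h) {r : ℝ} (hr : 0 < r)
    (x : ℝ) :
    HasDerivAt (gaussSmooth h (fun _ => 1) r) (r⁻¹ * gaussSmooth h (fun z => z) r x) x := by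
  have := hasDerivAt_gaussSmooth (q := fun _ => 1) (q' := fun _ => 0) hh
    (fun z => hasDerivAt_const z 1) continuous_const
    (fun z => (abs_pow_le_exp_four_mul z).1)
    (fun z => by simpa using (abs_pow_le_exp_four_mul z).2.1) hr x
  simpa using this

lemma hasDerivAt_gaussSmooth_id {h : ℝ → ℝ} (hh : LipschitzWith 1 h) {r : ℝ} (hr : 0 < r)
    (x : ℝ) :
    HasDerivAt (gaussSmooth h (fun z => z) r)
      (r⁻¹ * gaussSmooth h (fun z => z ^ 2 - 1) r x) x := by
  have := hasDerivAt_gaussSmooth (q := fun z => z) (q' := fun _ => 1) hh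
    (fun z => hasDerivAt_id z) continuous_const
    (fun z => (abs_pow_le_exp_four_mul z).2.1)
    (fun z => by simpa [← sq] using (abs_pow_le_exp_four_mul z).2.2.1) hr x
  simpa [← sq] using this

lemma hasDerivAt_gaussSmooth_sq_sub_one {h : ℝ → ℝ} (hh : LipschitzWith 1 h) {r : ℝ}
    (hr : 0 < r) (x : ℝ) :
    HasDerivAt (gaussSmooth h (fun z => z ^ 2 - 1) r)
      (r⁻¹ * gaussSmooth h (fun z => z ^ 3 - 3 * z) r x) x := by
  have e (z : ℝ) : z * (z ^ 2 - 1) - 2 * z = z ^ 3 - 3 * z := by ring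
  have := hasDerivAt_gaussSmooth (q := fun z => z ^ 2 - 1) (q' := fun z => 2 * z) hh
    (fun z => by simpa using (hasDerivAt_pow 2 z).sub_const 1) (by fun_prop)
    (fun z => (abs_pow_le_exp_four_mul z).2.2.1)
    (fun z => by rw [e]; exact (abs_pow_le_exp_four_mul z).2.2.2) hr x
  simpa [e] using this

lemma integrable_pow_stdNormal (n : ℕ) : Integrable (fun z : ℝ => z ^ n) stdNormal := by
  have := (memLp_id_gaussianReal (μ := 0) (v := 1) n).integrable_norm_pow'
  rw [← integrable_norm_iff (by fun_prop)]
  simpa [norm_pow] using this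

lemma integral_mul_sub_deriv_stdNormal {q q' : ℝ → ℝ} (hq : ∀ z, HasDerivAt q (q' z) z)
    (hq' : Continuous q') {K : ℝ} (hqK : ∀ z, |q z| ≤ K * exp (4 * |z|))
    (hqK' : ∀ z, |z * q z - q' z| ≤ K * exp (4 * |z|)) :
    ∫ z, z * q z - q' z ∂stdNormal = 0 := by
  have h1 := hasDerivAt_integral_shift_mul_stdNormal (g := fun _ => 1) (LipschitzWith.const 1)
    hq hq' hqK hqK' 0
  simp only [one_mul] at h1
  exact h1.unique (hasDerivAt_const _ _)

lemma integral_id_stdNormal : ∫ z, z ∂stdNormal = 0 := integral_id_gaussianReal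

lemma integral_sq_sub_one_stdNormal : ∫ z, z ^ 2 - 1 ∂stdNormal = 0 := by
  have := integral_mul_sub_deriv_stdNormal (q := fun z => z) (q' := fun _ => 1)
    (fun z => hasDerivAt_id z) continuous_const
    (fun z => (abs_pow_le_exp_four_mul z).2.1)
    (fun z => by simpa [← sq] using (abs_pow_le_exp_four_mul z).2.2.1)
  simpa [← sq] using this

lemma integral_sq_stdNormal : ∫ z, z ^ 2 ∂stdNormal = 1 := by
  have := integral_sq_sub_one_stdNormal
  rw [integral_sub (integrable_pow_stdNormal 2) (integrable_const _)] at this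
  simpa [sub_eq_zero] using this

lemma integral_cube_sub_stdNormal : ∫ z, z ^ 3 - 3 * z ∂stdNormal = 0 := by
  have e (z : ℝ) : z * (z ^ 2 - 1) - 2 * z = z ^ 3 - 3 * z := by ring
  have := integral_mul_sub_deriv_stdNormal (q := fun z => z ^ 2 - 1) (q' := fun z => 2 * z)
    (fun z => by simpa using (hasDerivAt_pow 2 z).sub_const 1) (by fun_prop)
    (fun z => (abs_pow_le_exp_four_mul z).2.2.1)
    (fun z => by rw [e]; exact (abs_pow_le_exp_four_mul z).2.2.2)
  simpa only [e] using this

lemma integral_pow_four_stdNormal : ∫ z, z ^ 4 ∂stdNormal = 3 := by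
  have hb (z : ℝ) : 1 ≤ exp |z| ∧ |z| ≤ exp |z| ∧ exp (4 * |z|) = exp |z| ^ 4 := by
    have h1 : |z| + 1 ≤ exp |z| := add_one_le_exp _
    have h0 := abs_nonneg z
    refine ⟨by linarith, by linarith, ?_⟩
    rw [← exp_nat_mul]; norm_num
  have := integral_mul_sub_deriv_stdNormal (q := fun z => z ^ 3) (q' := fun z => 3 * z ^ 2)
    (K := 4) (fun z => by simpa using hasDerivAt_pow 3 z) (by fun_prop)
    (fun z => by
      obtain ⟨h1, h2, h3⟩ := hb z
      rw [h3, abs_pow]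
      have e3 := pow_le_pow_right₀ h1 (show 3 ≤ 4 by norm_num)
      have f3 := pow_le_pow_left₀ (abs_nonneg z) h2 3
      have := pow_nonneg (zero_le_one.trans h1) 4
      linarith)
    (fun z => by
      obtain ⟨h1, h2, h3⟩ := hb z
      rw [h3]
      have e3 := pow_le_pow_right₀ h1 (show 2 ≤ 4 by norm_num)
      have f3 := pow_le_pow_left₀ (abs_nonneg z) h2 2
      have f4 := pow_le_pow_left₀ (abs_nonneg z) h2 4
      calc |z * z ^ 3 - 3 * z ^ 2| ≤ |z * z ^ 3| + |3 * z ^ 2| := abs_sub _ _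
        _ = |z| ^ 4 + 3 * |z| ^ 2 := by
          rw [← pow_succ', abs_pow, abs_mul, abs_pow]; norm_num
        _ ≤ _ := by linarith)
  simp only [← pow_succ'] at this
  rw [integral_sub (integrable_pow_stdNormal 4) ((integrable_pow_stdNormal 2).const_mul 3),
    integral_const_mul, integral_sq_stdNormal] at this
  linarith

lemma integrable_abs_cube_stdNormal : Integrable (fun z : ℝ => |z| ^ 3) stdNormal := by
  simpa [abs_pow] using (integrable_pow_stdNormal 3).abs

lemma integral_abs_cube_stdNormal_le : ∫ z, |z| ^ 3 ∂stdNormal ≤ 2 := by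
  have h2 := integrable_pow_stdNormal 2
  have h4 := integrable_pow_stdNormal 4
  calc ∫ z, |z| ^ 3 ∂stdNormal ≤ ∫ z, (z ^ 2 + z ^ 4) / 2 ∂stdNormal := by
        refine integral_mono integrable_abs_cube_stdNormal ((h2.add h4).div_const 2) fun z => ?_
        have e2 : z ^ 2 = |z| ^ 2 := (sq_abs z).symm
        have e4 : z ^ 4 = |z| ^ 4 := by rw [← abs_pow, abs_of_nonneg (by positivity)]
        simp only [e2, e4]
        nlinarith [mul_nonneg (sq_nonneg |z|) (sq_nonneg (|z| - 1))]
    _ = 2 := by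
        rw [integral_div, integral_add h2 h4, integral_sq_stdNormal, integral_pow_four_stdNormal]
        norm_num

lemma integral_abs_stdNormal_le : ∫ z, |z| ∂stdNormal ≤ 1 := by
  have h1 : Integrable (fun z : ℝ => |z|) stdNormal := by
    simpa using (integrable_pow_stdNormal 1).abs
  have h2 := integrable_pow_stdNormal 2
  calc ∫ z, |z| ∂stdNormal ≤ ∫ z, (z ^ 2 + 1) / 2 ∂stdNormal := by
        refine integral_mono h1 ((h2.add (integrable_const _)).div_const 2) fun z => ?_
        simp only
        nlinarith [sq_nonneg (|z| - 1), sq_abs z]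
    _ = 1 := by
        rw [integral_div, integral_add h2 (integrable_const _), integral_sq_stdNormal]
        norm_num

lemma integrable_gaussSmooth {h q : ℝ → ℝ} (hh : LipschitzWith 1 h) (hq : Continuous q)
    (hqK : ∀ z, |q z| ≤ 4 * exp (4 * |z|)) (r x : ℝ) :
    Integrable (fun z => h (x + r * z) * q z) stdNormal := by
  have hg : LipschitzWith (1 * ‖r‖₊) fun z => h (x + r * z) :=
    hh.comp (LipschitzWith.of_dist_le_mul fun a b => by
      simp [Real.dist_eq, ← mul_sub, abs_mul])
  simpa using integrable_shift_mul_stdNormal hg hq hqK 0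

lemma integrable_gaussSmooth_one {h : ℝ → ℝ} (hh : LipschitzWith 1 h) (r x : ℝ) :
    Integrable (fun z => h (x + r * z)) stdNormal := by
  simpa using integrable_gaussSmooth hh continuous_const
    (fun z => (abs_pow_le_exp_four_mul z).1) r x

lemma stronglyMeasurable_gaussSmooth {h q : ℝ → ℝ} (hh : Continuous h) (hq : Continuous q) :
    StronglyMeasurable fun p : ℝ × ℝ => gaussSmooth h q p.1 p.2 := by
  have : Continuous fun p : (ℝ × ℝ) × ℝ => h (p.1.2 + p.1.1 * p.2) * q p.2 := by fun_prop
  exact this.stronglyMeasurable.integral_prod_right'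

lemma lipschitzWith_gaussSmooth_one {h : ℝ → ℝ} (hh : LipschitzWith 1 h) (r : ℝ) :
    LipschitzWith 1 (gaussSmooth h (fun _ => 1) r) := by
  refine LipschitzWith.of_dist_le_mul fun x y => ?_
  simp only [gaussSmooth, mul_one, dist_eq_norm]
  rw [← integral_sub (integrable_gaussSmooth_one hh r x) (integrable_gaussSmooth_one hh r y)]
  refine (norm_integral_le_of_norm_le_const (C := ‖x - y‖)
    (Filter.Eventually.of_forall fun z => ?_)).trans (by simp)
  simpa [dist_eq_norm] using hh.dist_le_mul (x + r * z) (y + r * z)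

lemma abs_gaussSmooth_one_sub_le {h : ℝ → ℝ} (hh : LipschitzWith 1 h) (r r' x : ℝ) :
    |gaussSmooth h (fun _ => 1) r x - gaussSmooth h (fun _ => 1) r' x| ≤ |r - r'| := by
  simp only [gaussSmooth, mul_one, ← Real.norm_eq_abs]
  rw [← integral_sub (integrable_gaussSmooth_one hh r x) (integrable_gaussSmooth_one hh r' x)]
  have h1 : Integrable (fun z : ℝ => |z|) stdNormal := by
    simpa using (integrable_pow_stdNormal 1).abs
  refine (norm_integral_le_of_norm_le (h1.const_mul ‖r - r'‖)
    (Filter.Eventually.of_forall fun z => ?_)).trans ?_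
  · have := hh.dist_le_mul (x + r * z) (x + r' * z)
    simpa [dist_eq_norm, ← sub_mul] using this
  · rw [integral_const_mul]
    exact mul_le_of_le_one_right (norm_nonneg _) integral_abs_stdNormal_le

lemma gaussSmooth_one_zero (h : ℝ → ℝ) (x : ℝ) : gaussSmooth h (fun _ => 1) 0 x = h x := by
  simp [gaussSmooth]

lemma abs_gaussSmooth_le {h q P : ℝ → ℝ} (hh : LipschitzWith 1 h) (hq : Continuous q)
    (hqK : ∀ z, |q z| ≤ 4 * exp (4 * |z|)) (hq0 : ∫ z, q z ∂stdNormal = 0)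
    (hP : Integrable P stdNormal) (hqP : ∀ z, |z| * |q z| ≤ P z) {r : ℝ} (hr : 0 ≤ r) (x : ℝ) :
    |gaussSmooth h q r x| ≤ r * ∫ z, P z ∂stdNormal := by
  have i1 := integrable_gaussSmooth hh hq hqK r x
  have i2 : Integrable (fun z => h x * q z) stdNormal := by
    simpa using integrable_gaussSmooth hh hq hqK 0 x
  have e : gaussSmooth h q r x = ∫ z, (h (x + r * z) * q z - h x * q z) ∂stdNormal := by
    rw [integral_sub i1 i2, integral_const_mul, hq0, mul_zero, sub_zero, gaussSmooth]
  rw [e, ← integral_const_mul, ← Real.norm_eq_abs]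
  refine norm_integral_le_of_norm_le (hP.const_mul r) (Filter.Eventually.of_forall fun z => ?_)
  rw [← sub_mul, norm_mul]
  have h1 : |h (x + r * z) - h x| ≤ r * |z| := by
    have := hh.dist_le_mul (x + r * z) x
    simpa [Real.dist_eq, abs_mul, abs_of_nonneg hr] using this
  calc _ ≤ r * |z| * |q z| := by
          rw [Real.norm_eq_abs, Real.norm_eq_abs]; gcongr
    _ ≤ r * P z := by rw [mul_assoc]; gcongr; exact hqP z

lemma abs_gaussSmooth_id_le {h : ℝ → ℝ} (hh : LipschitzWith 1 h) {r : ℝ} (hr : 0 ≤ r) (x : ℝ) :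
    |gaussSmooth h (fun z => z) r x| ≤ r := by
  have := abs_gaussSmooth_le hh (q := fun z => z) (by fun_prop)
    (fun z => (abs_pow_le_exp_four_mul z).2.1) integral_id_stdNormal
    (integrable_pow_stdNormal 2) (fun z => by rw [← sq, sq_abs]) hr x
  rwa [integral_sq_stdNormal, mul_one] at this

lemma abs_gaussSmooth_sq_sub_one_le {h : ℝ → ℝ} (hh : LipschitzWith 1 h) {r : ℝ} (hr : 0 ≤ r)
    (x : ℝ) : |gaussSmooth h (fun z => z ^ 2 - 1) r x| ≤ 3 * r := by
  have h2 := integrable_pow_stdNormal 2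
  have h4 := integrable_pow_stdNormal 4
  have h42 : Integrable (fun z : ℝ => z ^ 4 + z ^ 2) stdNormal := h4.add h2
  have := abs_gaussSmooth_le hh (q := fun z => z ^ 2 - 1) (P := fun z => (z ^ 4 + z ^ 2 + 2) / 2)
    (by fun_prop)
    (fun z => (abs_pow_le_exp_four_mul z).2.2.1) integral_sq_sub_one_stdNormal
    ((h42.add (integrable_const _)).div_const 2) (fun z => by
      have : (z ^ 2 - 1) ^ 2 = |z ^ 2 - 1| ^ 2 := (sq_abs _).symm
      nlinarith [sq_nonneg (|z| - |z ^ 2 - 1|), sq_abs z, sq_nonneg z]) hr x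
  rw [integral_div, integral_add h42 (integrable_const _),
    integral_add h4 h2, integral_pow_four_stdNormal,
    integral_sq_stdNormal] at this
  norm_num at this
  linarith

lemma abs_gaussSmooth_cube_sub_le {h : ℝ → ℝ} (hh : LipschitzWith 1 h) {r : ℝ} (hr : 0 ≤ r)
    (x : ℝ) : |gaussSmooth h (fun z => z ^ 3 - 3 * z) r x| ≤ 6 * r := by
  have h2 := (integrable_pow_stdNormal 2).const_mul 3
  have h4 := integrable_pow_stdNormal 4
  have := abs_gaussSmooth_le hh (q := fun z => z ^ 3 - 3 * z) (P := fun z => z ^ 4 + 3 * z ^ 2)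
    (by fun_prop)
    (fun z => (abs_pow_le_exp_four_mul z).2.2.2) integral_cube_sub_stdNormal
    (h4.add h2) (fun z => by
      rw [← abs_mul, abs_le]
      constructor <;> nlinarith [sq_nonneg z, sq_nonneg (z ^ 2)]) hr x
  rw [integral_add h4 h2, integral_const_mul, integral_pow_four_stdNormal,
    integral_sq_stdNormal] at this
  linarith

lemma norm_le_of_hasDerivAt_le_pow {f f' : ℝ → ℝ} (hf : ∀ y, HasDerivAt f (f' y) y)
    (h0 : f 0 = 0) {C : ℝ} {k : ℕ} (hb : ∀ y, |f' y| ≤ C * (k + 1) * |y| ^ k) (y : ℝ) :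
    |f y| ≤ C * |y| ^ (k + 1) := by
  have pos (f f' : ℝ → ℝ) (hf : ∀ y, HasDerivAt f (f' y) y) (h0 : f 0 = 0)
      (hb : ∀ y, |f' y| ≤ C * (k + 1) * |y| ^ k) (y : ℝ) (hy : 0 ≤ y) :
      |f y| ≤ C * y ^ (k + 1) := by
    refine image_norm_le_of_norm_deriv_right_le_deriv_boundary (a := 0) (b := y) (f := f) (f' := f')
      (B := fun y => C * y ^ (k + 1)) (B' := fun y => C * (k + 1) * y ^ k)
      (fun z _ => (hf z).continuousAt.continuousWithinAt)
      (fun z _ => (hf z).hasDerivWithinAt) (by simp [h0])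
      (fun z => ((hasDerivAt_pow (k + 1) z).const_mul C).congr_deriv (by push_cast; ring_nf))
      (fun z hz => by simpa [abs_of_nonneg hz.1] using hb z) ⟨hy, le_rfl⟩
  rcases le_total 0 y with hy | hy
  · rw [abs_of_nonneg hy]; exact pos f f' hf h0 hb y hy
  · rw [abs_of_nonpos hy]
    have := pos (fun y => f (-y)) (fun y => -f' (-y))
      (fun y => ((hf (-y)).comp y (hasDerivAt_neg y)).congr_deriv (by ring)) (by simpa using h0)
      (fun y => by simpa using hb (-y)) (-y) (by linarith)
    simpa using this

lemma abs_taylor_two_le {f f1 f2 f3 : ℝ → ℝ} (h1 : ∀ x, HasDerivAt f (f1 x) x)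
    (h2 : ∀ x, HasDerivAt f1 (f2 x) x) (h3 : ∀ x, HasDerivAt f2 (f3 x) x) {M : ℝ}
    (hM : ∀ x, |f3 x| ≤ M) (x y : ℝ) :
    |f (x + y) - f x - f1 x * y - f2 x / 2 * y ^ 2| ≤ M / 6 * |y| ^ 3 := by
  have sh {g g1 : ℝ → ℝ} (hg : ∀ x, HasDerivAt g (g1 x) x) (y : ℝ) :
      HasDerivAt (fun y => g (x + y)) (g1 (x + y)) y := by
    simpa using (hg (x + y)).comp_const_add x y
  have b2 := norm_le_of_hasDerivAt_le_pow (k := 0) (C := M) (f := fun y => f2 (x + y) - f2 x)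
    (fun y => (sh h3 y).sub_const _) (by simp) (fun y => by simpa using hM (x + y))
  have b1 := norm_le_of_hasDerivAt_le_pow (k := 1) (C := M / 2)
    (f := fun y => f1 (x + y) - f1 x - f2 x * y)
    (fun y => (((sh h2 y).sub_const (f1 x)).sub ((hasDerivAt_id' y).const_mul (f2 x)))) (by simp)
    (fun y => by convert b2 y using 1 <;> norm_num)
  have b0 := norm_le_of_hasDerivAt_le_pow (k := 2) (C := M / 6)
    (f := fun y => f (x + y) - f x - f1 x * y - f2 x / 2 * y ^ 2)
    (fun y => (((sh h1 y).sub_const (f x)).sub ((hasDerivAt_id' y).const_mul (f1 x))).sub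
      ((hasDerivAt_pow 2 y).const_mul (f2 x / 2))) (by simp)
    (fun y => by convert b1 y using 1 <;> norm_num <;> ring_nf; simp)
  exact b0 y

lemma abs_gaussSmooth_taylor_le {h : ℝ → ℝ} (hh : LipschitzWith 1 h) {r : ℝ} (hr : 0 < r)
    (x y : ℝ) :
    |gaussSmooth h (fun _ => 1) r (x + y) - gaussSmooth h (fun _ => 1) r x
      - r⁻¹ * gaussSmooth h (fun z => z) r x * y
      - (r⁻¹ * (r⁻¹ * gaussSmooth h (fun z => z ^ 2 - 1) r x)) / 2 * y ^ 2|
      ≤ |y| ^ 3 / r ^ 2 := by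
  have := abs_taylor_two_le (M := 6 / r ^ 2)
    (fun x => hasDerivAt_gaussSmooth_one hh hr x)
    (fun x => (hasDerivAt_gaussSmooth_id hh hr x).const_mul r⁻¹)
    (fun x => ((hasDerivAt_gaussSmooth_sq_sub_one hh hr x).const_mul r⁻¹).const_mul r⁻¹)
    (fun x => by
      rw [abs_mul, abs_mul, abs_mul, abs_of_pos (inv_pos.2 hr)]
      calc _ ≤ r⁻¹ * (r⁻¹ * (r⁻¹ * (6 * r))) := by
            gcongr; exact abs_gaussSmooth_cube_sub_le hh hr.le x
        _ = _ := by field_simp) x y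
  refine this.trans_eq (by ring)

/-- The heat semigroup property of Gaussian smoothing. -/
lemma gaussSmooth_one_sqrt_add {h : ℝ → ℝ} (hh : LipschitzWith 1 h) (r v : ℝ) (x : ℝ) :
    gaussSmooth h (fun _ => 1) √(r ^ 2 + v ^ 2) x
      = ∫ z, gaussSmooth h (fun _ => 1) r (x + v * z) ∂stdNormal := by
  have hm (a : ℝ) : stdNormal.map (fun z => a * z) = gaussianReal 0 (Real.toNNReal (a ^ 2)) := by
    rw [gaussianReal_map_const_mul, mul_zero, mul_one, Real.toNNReal_of_nonneg (sq_nonneg a)]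
  have hc := hh.continuous
  have hconv := gaussianReal_conv_gaussianReal (m₁ := 0) (m₂ := 0)
    (v₁ := Real.toNNReal (v ^ 2)) (v₂ := Real.toNNReal (r ^ 2))
  rw [← Real.toNNReal_add (sq_nonneg v) (sq_nonneg r), zero_add, add_comm (v ^ 2),
    ← Real.sq_sqrt (show 0 ≤ r ^ 2 + v ^ 2 by positivity), ← hm, ← hm, ← hm] at hconv
  simp only [gaussSmooth, mul_one]
  calc ∫ z, h (x + √(r ^ 2 + v ^ 2) * z) ∂stdNormal
      = ∫ y, h (x + y) ∂(stdNormal.map (fun z => √(r ^ 2 + v ^ 2) * z)) := by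
        rw [integral_map (by fun_prop) (Continuous.aestronglyMeasurable (by fun_prop))]
    _ = _ := by
        have inner (z : ℝ) : ∫ y, h (x + (z + y)) ∂(stdNormal.map (fun z => r * z))
            = gaussSmooth h (fun _ => 1) r (x + z) := by
          rw [integral_map (by fun_prop) (Continuous.aestronglyMeasurable (by fun_prop))]
          simp only [gaussSmooth, add_assoc, mul_one]
        have hcu := (lipschitzWith_gaussSmooth_one hh r).continuous
        rw [← hconv, integral_conv]
        · simp_rw [inner]
          rw [integral_map (by fun_prop) (Continuous.aestronglyMeasurable (by fun_prop))]
          simp only [gaussSmooth, mul_one]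
        · rw [hconv, integrable_map_measure (Continuous.aestronglyMeasurable (by fun_prop))
            (by fun_prop)]
          exact integrable_gaussSmooth_one hh _ x

lemma abs_gaussSmooth_heat_step_le {h : ℝ → ℝ} (hh : LipschitzWith 1 h) {r : ℝ} (hr : 0 < r)
    (v x : ℝ) :
    |gaussSmooth h (fun _ => 1) √(r ^ 2 + v ^ 2) x - gaussSmooth h (fun _ => 1) r x
      - (r⁻¹ * (r⁻¹ * gaussSmooth h (fun z => z ^ 2 - 1) r x)) / 2 * v ^ 2|
      ≤ 2 * |v| ^ 3 / r ^ 2 := by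
  set U := gaussSmooth h (fun _ => 1) r with hU
  set u1 := r⁻¹ * gaussSmooth h (fun z => z) r x
  set u2 := r⁻¹ * (r⁻¹ * gaussSmooth h (fun z => z ^ 2 - 1) r x)
  have i0 : Integrable (fun z => U (x + v * z)) stdNormal :=
    integrable_gaussSmooth_one (lipschitzWith_gaussSmooth_one hh r) v x
  have i1 : Integrable (fun z => u1 * (v * z)) stdNormal := by
    simpa using ((integrable_pow_stdNormal 1).const_mul v).const_mul u1
  have i2 : Integrable (fun z => u2 / 2 * (v * z) ^ 2) stdNormal := by
    simpa [mul_pow] using ((integrable_pow_stdNormal 2).const_mul (v ^ 2)).const_mul (u2 / 2)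
  have e : ∫ z, (U (x + v * z) - U x - u1 * (v * z) - u2 / 2 * (v * z) ^ 2) ∂stdNormal
      = gaussSmooth h (fun _ => 1) √(r ^ 2 + v ^ 2) x - U x - u2 / 2 * v ^ 2 := by
    have i3 : Integrable (fun z => U (x + v * z) - U x) stdNormal := i0.sub (integrable_const _)
    have i4 : Integrable (fun z => U (x + v * z) - U x - u1 * (v * z)) stdNormal := i3.sub i1
    rw [integral_sub i4 i2, integral_sub i3 i1, integral_sub i0 (integrable_const _),
      integral_const_mul, integral_const_mul, integral_id_stdNormal, integral_const_mul]
    simp only [mul_pow]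
    rw [integral_const_mul, integral_sq_stdNormal, gaussSmooth_one_sqrt_add hh]
    simp [hU]
  rw [← e, ← Real.norm_eq_abs]
  refine (norm_integral_le_of_norm_le
    (integrable_abs_cube_stdNormal.const_mul (|v| ^ 3 / r ^ 2))
    (Filter.Eventually.of_forall fun z => ?_)).trans ?_
  · refine (abs_gaussSmooth_taylor_le hh hr x (v * z)).trans_eq ?_
    rw [abs_mul]; ring
  · rw [integral_const_mul]
    calc _ ≤ |v| ^ 3 / r ^ 2 * 2 := by gcongr; exact integral_abs_cube_stdNormal_le
      _ = _ := by ring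

/-- Comparison of one increment with the heat flow, as a pointwise second-order expansion. -/
lemma abs_gaussSmooth_increment_le {h : ℝ → ℝ} (hh : LipschitzWith 1 h) {r : ℝ} (hr : 0 < r)
    {w : ℝ} (hw : 0 ≤ w) (x y : ℝ) :
    |gaussSmooth h (fun _ => 1) r (x + y) - gaussSmooth h (fun _ => 1) √(r ^ 2 + w) x
      - r⁻¹ * gaussSmooth h (fun z => z) r x * y
      - (r⁻¹ * (r⁻¹ * gaussSmooth h (fun z => z ^ 2 - 1) r x)) / 2 * (y ^ 2 - w)|
      ≤ (|y| ^ 3 + 2 * (w * √w)) / r ^ 2 := by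
  have h1 := abs_gaussSmooth_taylor_le hh hr x y
  have h2 := abs_gaussSmooth_heat_step_le hh hr √w x
  rw [Real.sq_sqrt hw, abs_of_nonneg (Real.sqrt_nonneg w), pow_succ √w 2, Real.sq_sqrt hw] at h2
  rw [add_div]
  refine le_trans (le_of_eq ?_) ((abs_sub _ _).trans (add_le_add h1 h2))
  congr 1
  ring

lemma integrable_gaussSmooth_one_comp {Ω : Type*} {m : MeasurableSpace Ω} {μ : Measure Ω}
    [IsProbabilityMeasure μ] {h : ℝ → ℝ} (hh : LipschitzWith 1 h) {r x : Ω → ℝ}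
    (hr : AEStronglyMeasurable r μ) (hx : Integrable x μ) {b : ℝ} (hrb : ∀ ω, |r ω| ≤ b) :
    Integrable (fun ω => gaussSmooth h (fun _ => 1) (r ω) (x ω)) μ := by
  refine ((integrable_const (b + |h 0|)).add hx.abs).mono'
    ((stronglyMeasurable_gaussSmooth hh.continuous continuous_const).measurable.comp_aemeasurable
      (hr.aemeasurable.prodMk hx.aestronglyMeasurable.aemeasurable)).aestronglyMeasurable
    (Filter.Eventually.of_forall fun ω => ?_)
  have h1 := abs_gaussSmooth_one_sub_le hh (r ω) 0 (x ω)
  rw [gaussSmooth_one_zero, sub_zero] at h1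
  have h2 : |h (x ω) - h 0| ≤ |x ω| := by simpa [Real.dist_eq] using hh.dist_le_mul (x ω) 0
  have h3 := abs_add_three (gaussSmooth h (fun _ => 1) (r ω) (x ω) - h (x ω)) (h (x ω) - h 0) (h 0)
  rw [sub_add_sub_cancel, sub_add_cancel] at h3
  simp only [Real.norm_eq_abs, Pi.add_apply]
  linarith [hrb ω]

/-- `Y` is an increment with conditional mean `0`, conditional variance `w` and conditional third
absolute moment at most `δ w`, all tested against bounded `𝒢`-measurable functions. -/
structure IsIncrement {Ω : Type*} {m : MeasurableSpace Ω} (μ : Measure Ω) (𝒢 : MeasurableSpace Ω)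
    (δ : ℝ) (Y w : Ω → ℝ) : Prop where
  memLp : MemLp Y 3 μ
  stronglyMeasurable : StronglyMeasurable[𝒢] w
  nonneg : ∀ ω, 0 ≤ w ω
  le_sq : ∀ ω, w ω ≤ δ ^ 2
  integral_mul : ∀ (f : Ω → ℝ) (C : ℝ), StronglyMeasurable[𝒢] f → (∀ ω, |f ω| ≤ C) →
    ∫ ω, f ω * Y ω ∂μ = 0
  integral_mul_sq : ∀ (f : Ω → ℝ) (C : ℝ), StronglyMeasurable[𝒢] f → (∀ ω, |f ω| ≤ C) →
    ∫ ω, f ω * Y ω ^ 2 ∂μ = ∫ ω, f ω * w ω ∂μ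
  integral_mul_cube_le : ∀ (f : Ω → ℝ) (C : ℝ), StronglyMeasurable[𝒢] f → (∀ ω, |f ω| ≤ C) →
    (∀ ω, 0 ≤ f ω) → ∫ ω, f ω * |Y ω| ^ 3 ∂μ ≤ δ * ∫ ω, f ω * w ω ∂μ

namespace IsIncrement

variable {Ω : Type*} {m : MeasurableSpace Ω} {μ : Measure Ω}
  {𝒢 : MeasurableSpace Ω} {δ : ℝ} {Y w : Ω → ℝ}

lemma integrable [IsProbabilityMeasure μ] (hY : IsIncrement μ 𝒢 δ Y w) : Integrable Y μ :=
  hY.memLp.integrable (by norm_num)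

lemma integrable_sq [IsProbabilityMeasure μ] (hY : IsIncrement μ 𝒢 δ Y w) :
    Integrable (fun ω => Y ω ^ 2) μ :=
  (hY.memLp.mono_exponent (by norm_num)).integrable_sq

lemma integrable_abs_cube (hY : IsIncrement μ 𝒢 δ Y w) : Integrable (fun ω => |Y ω| ^ 3) μ := by
  simpa using hY.memLp.integrable_norm_pow (p := 3) (by norm_num)

lemma integrable_var [IsProbabilityMeasure μ] (h𝒢 : 𝒢 ≤ m) (hY : IsIncrement μ 𝒢 δ Y w) :
    Integrable w μ :=
  (integrable_const (δ ^ 2)).mono' (hY.stronglyMeasurable.mono h𝒢).aestronglyMeasurable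
    (Filter.Eventually.of_forall fun ω => by
      rw [Real.norm_eq_abs, abs_of_nonneg (hY.nonneg ω)]; exact hY.le_sq ω)

/-- Switching an increment on or off by a predictable event. -/
lemma indicator (hY : IsIncrement μ 𝒢 δ Y w) (h𝒢 : 𝒢 ≤ m) {s : Set Ω}
    (hs : MeasurableSet[𝒢] s) : IsIncrement μ 𝒢 δ (s.indicator Y) (s.indicator w) := by
  have hind (f g : Ω → ℝ) (ω : Ω) : f ω * s.indicator g ω = s.indicator f ω * g ω := by
    by_cases h : ω ∈ s <;> simp [h]
  have hb {f : Ω → ℝ} {C : ℝ} (hf : ∀ ω, |f ω| ≤ C) (ω : Ω) : |s.indicator f ω| ≤ C := by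
    by_cases h : ω ∈ s
    · simpa [h] using hf ω
    · simpa [h] using (abs_nonneg _).trans (hf ω)
  refine ⟨hY.memLp.indicator (h𝒢 s hs), hY.stronglyMeasurable.indicator hs,
    fun ω => Set.indicator_nonneg (fun ω _ => hY.nonneg ω) ω, fun ω => ?_, fun f C hf hC => ?_,
    fun f C hf hC => ?_, fun f C hf hC h0 => ?_⟩
  · by_cases h : ω ∈ s
    · simpa [h] using hY.le_sq ω
    · simpa [h] using sq_nonneg δ
  · simp_rw [hind]
    exact hY.integral_mul _ C (hf.indicator hs) (hb hC)
  · have (ω : Ω) : s.indicator Y ω ^ 2 = s.indicator (fun ω => Y ω ^ 2) ω := by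
      by_cases h : ω ∈ s <;> simp [h]
    simp_rw [this, hind]
    exact hY.integral_mul_sq _ C (hf.indicator hs) (hb hC)
  · have (ω : Ω) : |s.indicator Y ω| ^ 3 = s.indicator (fun ω => |Y ω| ^ 3) ω := by
      by_cases h : ω ∈ s <;> simp [h]
    simp_rw [this, hind]
    exact hY.integral_mul_cube_le _ C (hf.indicator hs) (hb hC)
      (fun ω => Set.indicator_nonneg (fun ω _ => h0 ω) ω)

/-- One step of the Lindeberg replacement. -/
lemma abs_integral_gaussSmooth_sub_le [IsProbabilityMeasure μ]
    (hY : IsIncrement μ 𝒢 δ Y w) (h𝒢 : 𝒢 ≤ m) (hδ : 0 ≤ δ)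
    {h : ℝ → ℝ} (hh : LipschitzWith 1 h) {S R : Ω → ℝ} (hS : StronglyMeasurable[𝒢] S)
    (hSi : Integrable S μ) (hR : StronglyMeasurable[𝒢] R) {a b : ℝ} (ha : 0 < a)
    (haR : ∀ ω, a ≤ R ω) (hRb : ∀ ω, R ω ≤ b) :
    |∫ ω, gaussSmooth h (fun _ => 1) (R ω) (S ω + Y ω) ∂μ
      - ∫ ω, gaussSmooth h (fun _ => 1) √(R ω ^ 2 + w ω) (S ω) ∂μ|
      ≤ 3 * δ * ∫ ω, w ω / R ω ^ 2 ∂μ := by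
  have hR0 (ω : Ω) : 0 < R ω := ha.trans_le (haR ω)
  have hw := hY.stronglyMeasurable
  have hcomp {q : ℝ → ℝ} (hq : Continuous q) :
      StronglyMeasurable[𝒢] fun ω => gaussSmooth h q (R ω) (S ω) :=
    (stronglyMeasurable_gaussSmooth hh.continuous hq).comp_measurable
      (hR.measurable.prodMk hS.measurable)
  have hinv : StronglyMeasurable[𝒢] fun ω => (R ω)⁻¹ := hR.measurable.inv.stronglyMeasurable
  set f1 : Ω → ℝ := fun ω => (R ω)⁻¹ * gaussSmooth h (fun z => z) (R ω) (S ω) with hf1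
  set f2 : Ω → ℝ := fun ω =>
    ((R ω)⁻¹ * ((R ω)⁻¹ * gaussSmooth h (fun z => z ^ 2 - 1) (R ω) (S ω))) / 2 with hf2
  have hf1m : StronglyMeasurable[𝒢] f1 := hinv.mul (hcomp (by fun_prop))
  have hf2m : StronglyMeasurable[𝒢] f2 :=
    ((hinv.mul (hinv.mul (hcomp (by fun_prop)))).measurable.div_const 2).stronglyMeasurable
  have hinva (ω : Ω) : (R ω)⁻¹ ≤ a⁻¹ := inv_anti₀ ha (haR ω)
  have hf1b (ω : Ω) : |f1 ω| ≤ 1 := by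
    rw [hf1, abs_mul, abs_of_pos (inv_pos.2 (hR0 ω))]
    calc _ ≤ (R ω)⁻¹ * R ω :=
          mul_le_mul_of_nonneg_left (abs_gaussSmooth_id_le hh (hR0 ω).le _)
            (inv_pos.2 (hR0 ω)).le
      _ = 1 := inv_mul_cancel₀ (hR0 ω).ne'
  have hf2b (ω : Ω) : |f2 ω| ≤ 3 * a⁻¹ / 2 := by
    have hp := inv_pos.2 (hR0 ω)
    rw [hf2, abs_div, abs_mul, abs_mul, abs_of_pos hp, abs_two]
    refine div_le_div_of_nonneg_right ?_ zero_le_two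
    calc _ ≤ (R ω)⁻¹ * ((R ω)⁻¹ * (3 * R ω)) := by
          gcongr
          exact abs_gaussSmooth_sq_sub_one_le hh (hR0 ω).le _
      _ = 3 * (R ω)⁻¹ := by
          have := (hR0 ω).ne'
          field_simp
      _ ≤ 3 * a⁻¹ := mul_le_mul_of_nonneg_left (hinva ω) (by norm_num)
  have hf3m : StronglyMeasurable[𝒢] fun ω => (R ω ^ 2)⁻¹ :=
    (hR.measurable.pow_const 2).inv.stronglyMeasurable
  have hf3b (ω : Ω) : |(R ω ^ 2)⁻¹| ≤ (a ^ 2)⁻¹ := by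
    rw [abs_of_pos (by have := hR0 ω; positivity)]
    exact inv_anti₀ (by positivity) (by gcongr; exact haR ω)
  have hiY := hY.integrable
  have hiY2 := hY.integrable_sq
  have hiY3 := hY.integrable_abs_cube
  have hiw := hY.integrable_var h𝒢
  have bmul {f g : Ω → ℝ} {C : ℝ} (hg : Integrable g μ) (hf : StronglyMeasurable[𝒢] f)
      (hC : ∀ ω, |f ω| ≤ C) : Integrable (fun ω => f ω * g ω) μ :=
    hg.bdd_mul (hf.mono h𝒢).aestronglyMeasurable (Filter.Eventually.of_forall hC)
  have j1 := bmul hiY hf1m hf1b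
  have j2 := bmul hiY2 hf2m hf2b
  have j2w := bmul hiw hf2m hf2b
  have j3 := bmul hiY3 hf3m hf3b
  have j3w := bmul hiw hf3m hf3b
  have hRb' (ω : Ω) : |R ω| ≤ b := by rw [abs_of_pos (hR0 ω)]; exact hRb ω
  have hA : Integrable (fun ω => gaussSmooth h (fun _ => 1) (R ω) (S ω + Y ω)) μ :=
    integrable_gaussSmooth_one_comp hh (hR.mono h𝒢).aestronglyMeasurable (hSi.add hiY) hRb'
  have hsq : StronglyMeasurable[𝒢] fun ω => √(R ω ^ 2 + w ω) :=
    (Real.continuous_sqrt.measurable.comp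
      ((hR.measurable.pow_const 2).add hw.measurable)).stronglyMeasurable
  have hB := integrable_gaussSmooth_one_comp hh (hsq.mono h𝒢).aestronglyMeasurable hSi
    (b := √(b ^ 2 + δ ^ 2)) (fun ω => by
      rw [abs_of_nonneg (Real.sqrt_nonneg _)]
      exact Real.sqrt_le_sqrt (add_le_add (pow_le_pow_left₀ (hR0 ω).le (hRb ω) 2) (hY.le_sq ω)))
  have hzero : ∫ ω, f2 ω * (Y ω ^ 2 - w ω) ∂μ = 0 := by
    simp_rw [mul_sub]
    rw [integral_sub j2 j2w, hY.integral_mul_sq f2 _ hf2m hf2b, sub_self]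
  have j2' : Integrable (fun ω => f2 ω * (Y ω ^ 2 - w ω)) μ := by
    simp_rw [mul_sub]
    exact j2.sub j2w
  have hAB : Integrable (fun ω => gaussSmooth h (fun _ => 1) (R ω) (S ω + Y ω)
      - gaussSmooth h (fun _ => 1) √(R ω ^ 2 + w ω) (S ω)) μ := hA.sub hB
  have hABY : Integrable (fun ω => gaussSmooth h (fun _ => 1) (R ω) (S ω + Y ω)
      - gaussSmooth h (fun _ => 1) √(R ω ^ 2 + w ω) (S ω) - f1 ω * Y ω) μ := hAB.sub j1
  have e : ∫ ω, (gaussSmooth h (fun _ => 1) (R ω) (S ω + Y ω)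
        - gaussSmooth h (fun _ => 1) √(R ω ^ 2 + w ω) (S ω) - f1 ω * Y ω
        - f2 ω * (Y ω ^ 2 - w ω)) ∂μ
      = ∫ ω, gaussSmooth h (fun _ => 1) (R ω) (S ω + Y ω) ∂μ
        - ∫ ω, gaussSmooth h (fun _ => 1) √(R ω ^ 2 + w ω) (S ω) ∂μ := by
    rw [integral_sub hABY j2', hzero, sub_zero, integral_sub hAB j1,
      hY.integral_mul f1 _ hf1m hf1b, sub_zero,
      integral_sub hA hB]
  rw [← e, ← Real.norm_eq_abs]
  have hsqrt (ω : Ω) : √(w ω) ≤ δ := Real.sqrt_le_iff.2 ⟨hδ, hY.le_sq ω⟩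
  refine (norm_integral_le_of_norm_le (j3.add (j3w.const_mul (2 * δ)))
    (Filter.Eventually.of_forall fun ω => ?_)).trans ?_
  · refine (abs_gaussSmooth_increment_le hh (hR0 ω) (hY.nonneg ω) (S ω) (Y ω)).trans ?_
    have hp : 0 ≤ (R ω ^ 2)⁻¹ := by positivity
    simp only [Pi.add_apply]
    rw [div_eq_mul_inv]
    nlinarith [mul_nonneg hp (mul_nonneg (hY.nonneg ω) (sub_nonneg.2 (hsqrt ω)))]
  · have h3 := hY.integral_mul_cube_le _ _ hf3m hf3b fun ω => by positivity
    have e3 : ∫ ω, w ω / R ω ^ 2 ∂μ = ∫ ω, (R ω ^ 2)⁻¹ * w ω ∂μ := by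
      simp_rw [div_eq_inv_mul]
    simp only [Pi.add_apply]
    rw [integral_add j3 (j3w.const_mul _), integral_const_mul, e3]
    linarith

end IsIncrement

section Sums

variable {Ω : Type*} {m : MeasurableSpace Ω} {μ : Measure Ω} [IsProbabilityMeasure μ]
  {ℱ : Filtration ℕ m} {δ : ℝ} {ξ w : ℕ → Ω → ℝ}

lemma stronglyMeasurable_sum_range {w : ℕ → Ω → ℝ} {N : ℕ} {j : ℕ}
    (hw : ∀ k < N, StronglyMeasurable[ℱ (k + j)] (w k)) {k l : ℕ} (hk : k ≤ N)
    (hl : k + j ≤ l + 1) :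
    StronglyMeasurable[ℱ l] fun ω => ∑ i ∈ range k, w i ω :=
  Finset.stronglyMeasurable_fun_sum _ fun i hi =>
    (hw i ((mem_range.1 hi).trans_le hk)).mono (ℱ.mono (by have := mem_range.1 hi; omega))

/-- Lindeberg's replacement along a martingale whose total conditional variance does not
exceed `s`; the unused variance is supplied by the heat flow. -/
lemma abs_integral_gaussSmooth_martingale_le {n : ℕ} (hδ : 0 ≤ δ)
    (hξm : ∀ k < n, StronglyMeasurable[ℱ (k + 1)] (ξ k))
    (hξ : ∀ k < n, IsIncrement μ (ℱ k) δ (ξ k) (w k)) {B : ℝ} (hB : 0 < B)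
    (hwB : ∀ k < n, ∀ ω, w k ω ≤ B ^ 2) {s : ℝ} (hs : ∀ ω, ∑ k ∈ range n, w k ω ≤ s)
    {h : ℝ → ℝ} (hh : LipschitzWith 1 h) {l : ℕ} (hl : l ≤ n) :
    |∫ ω, gaussSmooth h (fun _ => 1) √(s - ∑ k ∈ range l, w k ω + 2 * B ^ 2)
        (∑ k ∈ range l, ξ k ω) ∂μ - gaussSmooth h (fun _ => 1) √(s + 2 * B ^ 2) 0|
      ≤ 3 * δ * ∫ ω, (log (s + B ^ 2) - log (s - ∑ k ∈ range l, w k ω + B ^ 2)) ∂μ := by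
  have hB2 : 0 < B ^ 2 := by positivity
  have hpart {l : ℕ} (hl : l ≤ n) (ω : Ω) : ∑ k ∈ range l, w k ω ≤ s :=
    (sum_le_sum_of_subset_of_nonneg (range_subset_range.2 hl) fun k hk _ =>
      (hξ k (mem_range.1 hk)).nonneg ω).trans (hs ω)
  have hpos {l : ℕ} (hl : l ≤ n) (ω : Ω) : 0 ≤ ∑ k ∈ range l, w k ω :=
    sum_nonneg fun k hk => (hξ k ((mem_range.1 hk).trans_le hl)).nonneg ω
  have hWm {l : ℕ} (hl : l ≤ n) {j : ℕ} (hlj : l ≤ j + 1) :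
      StronglyMeasurable[ℱ j] fun ω => ∑ k ∈ range l, w k ω :=
    stronglyMeasurable_sum_range (j := 0) (fun k hk => (hξ k hk).stronglyMeasurable) hl hlj
  have hlog {l : ℕ} (hl : l ≤ n) :
      Integrable (fun ω => log (s - ∑ k ∈ range l, w k ω + B ^ 2)) μ := by
    refine (integrable_const (max |log (B ^ 2)| |log (s + B ^ 2)|)).mono'
      ((((hWm hl (Nat.le_succ l)).mono (ℱ.le _)).measurable.const_sub s).add_const
        (B ^ 2)).log.aestronglyMeasurable (Filter.Eventually.of_forall fun ω => ?_)
    have h1 := hpart hl ω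
    have h2 := hpos hl ω
    exact abs_le_max_abs_abs (log_le_log hB2 (by linarith)) (log_le_log (by linarith) (by linarith))
  induction l with
  | zero => simp
  | succ l ih =>
    have hl' : l < n := hl
    have ih := ih hl'.le
    have hi := hξ l hl'
    set R : Ω → ℝ := fun ω => √(s - ∑ k ∈ range (l + 1), w k ω + 2 * B ^ 2) with hR
    have hRsq (ω : Ω) : R ω ^ 2 = s - ∑ k ∈ range (l + 1), w k ω + 2 * B ^ 2 :=
      Real.sq_sqrt (by linarith [hpart hl ω])
    have hRm : StronglyMeasurable[ℱ l] R :=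
      (((hWm hl le_rfl).measurable.const_sub s).add_const _).sqrt.stronglyMeasurable
    have step := hi.abs_integral_gaussSmooth_sub_le (ℱ.le l) hδ hh (R := R)
      (S := fun ω => ∑ k ∈ range l, ξ k ω) (a := √(2 * B ^ 2)) (b := √(s + 2 * B ^ 2))
      (stronglyMeasurable_sum_range hξm hl'.le le_rfl)
      (integrable_finsetSum _ fun k hk => (hξ k ((mem_range.1 hk).trans hl')).integrable)
      hRm (by positivity)
      (fun ω => Real.sqrt_le_sqrt (by linarith [hpart hl ω]))
      (fun ω => Real.sqrt_le_sqrt (by linarith [hpos hl ω]))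
    have hsum (ω : Ω) : R ω ^ 2 + w l ω = s - ∑ k ∈ range l, w k ω + 2 * B ^ 2 := by
      rw [hRsq, sum_range_succ]; ring
    simp_rw [hsum, ← sum_range_succ (fun k => ξ k _) l] at step
    have hlogl := hlog hl'.le
    have hlogl1 := hlog hl
    have hfrac : ∫ ω, w l ω / R ω ^ 2 ∂μ ≤ ∫ ω, (log (s - ∑ k ∈ range l, w k ω + B ^ 2)
        - log (s - ∑ k ∈ range (l + 1), w k ω + B ^ 2)) ∂μ := by
      refine integral_mono_of_nonneg (Filter.Eventually.of_forall fun ω =>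
        div_nonneg (hi.nonneg ω) (sq_nonneg _)) (hlogl.sub hlogl1)
        (Filter.Eventually.of_forall fun ω => ?_)
      have hy : 0 < s - ∑ k ∈ range (l + 1), w k ω + B ^ 2 := by linarith [hpart hl ω]
      have hx : 0 < s - ∑ k ∈ range l, w k ω + B ^ 2 := by linarith [hpart hl'.le ω]
      have hxy : s - ∑ k ∈ range l, w k ω + B ^ 2
          = s - ∑ k ∈ range (l + 1), w k ω + B ^ 2 + w l ω := by
        rw [sum_range_succ]; ring
      have hx2 : s - ∑ k ∈ range l, w k ω + B ^ 2 ≤ R ω ^ 2 := by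
        rw [hxy, hRsq]; linarith [hwB l hl' ω]
      beta_reduce
      rw [← log_div hx.ne' hy.ne']
      calc w l ω / R ω ^ 2 ≤ w l ω / (s - ∑ k ∈ range l, w k ω + B ^ 2) :=
            div_le_div_of_nonneg_left (hi.nonneg ω) hx hx2
        _ = 1 - ((s - ∑ k ∈ range l, w k ω + B ^ 2)
              / (s - ∑ k ∈ range (l + 1), w k ω + B ^ 2))⁻¹ := by
            rw [inv_div, eq_sub_iff_add_eq, ← add_div, div_eq_one_iff_eq hx.ne', hxy]; ring
        _ ≤ _ := one_sub_inv_le_log_of_pos (div_pos hx hy)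
    rw [integral_sub (integrable_const _) hlogl] at ih
    rw [integral_sub hlogl hlogl1] at hfrac
    rw [integral_sub (integrable_const _) hlogl1]
    have := mul_le_mul_of_nonneg_left hfrac (by positivity : 0 ≤ 3 * δ)
    refine (abs_sub_le _ _ _).trans ((add_le_add (step.trans this) ih).trans_eq ?_)
    ring

end Sums

lemma sum_stopped_bounds {v : ℕ → ℝ} {b c : ℝ} (hc : 0 ≤ c) {n : ℕ}
    (hv0 : ∀ k < n, 0 ≤ v k) (hvb : ∀ k < n, v k ≤ b) :
    (∑ k ∈ range n, if ∑ i ∈ range (k + 1), v i ≤ c then v k else 0) ≤ c ∧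
    (∑ i ∈ range n, v i ≤ c →
      (∑ k ∈ range n, if ∑ i ∈ range (k + 1), v i ≤ c then v k else 0) = ∑ i ∈ range n, v i) ∧
    (c < ∑ i ∈ range n, v i →
      c - b ≤ ∑ k ∈ range n, if ∑ i ∈ range (k + 1), v i ≤ c then v k else 0) := by
  induction n with
  | zero => simp [hc, not_lt.2 hc]
  | succ n ih =>
    obtain ⟨h1, h2, h3⟩ := ih (fun k hk => hv0 k (by omega)) (fun k hk => hvb k (by omega))
    have h0 := hv0 n (by omega)
    have hb := hvb n (by omega)
    rw [sum_range_succ _ n, sum_range_succ v n]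
    by_cases hV : ∑ i ∈ range n, v i + v n ≤ c
    · rw [if_pos hV, h2 (by linarith)]
      exact ⟨hV, fun _ => rfl, fun h => absurd hV (not_le.2 h)⟩
    · rw [if_neg hV, add_zero]
      refine ⟨h1, fun h => absurd h hV, fun _ => ?_⟩
      rcases le_or_gt (∑ i ∈ range n, v i) c with h | h
      · rw [h2 h]; linarith [not_le.1 hV]
      · exact h3 h

section SecondMoment

variable {Ω : Type*} {m : MeasurableSpace Ω} {μ : Measure Ω} [IsProbabilityMeasure μ]

lemma integral_abs_le_sqrt_integral_sq {f : Ω → ℝ} (hf : MemLp f 2 μ) :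
    ∫ ω, |f ω| ∂μ ≤ √(∫ ω, f ω ^ 2 ∂μ) := by
  have h := variance_nonneg |f| μ
  rw [variance_eq_sub hf.abs] at h
  refine Real.le_sqrt_of_sq_le ?_
  simpa using h

lemma integral_sqrt_le {f : Ω → ℝ} (hf : Integrable f μ) (h0 : ∀ ω, 0 ≤ f ω) :
    ∫ ω, √(f ω) ∂μ ≤ √(∫ ω, f ω ∂μ) := by
  have hm : MemLp (fun ω => √(f ω)) 2 μ :=
    (memLp_two_iff_integrable_sq
      (Real.continuous_sqrt.comp_aestronglyMeasurable hf.aestronglyMeasurable)).2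
      (by simpa only [Real.sq_sqrt (h0 _)] using hf)
  simpa only [abs_of_nonneg (Real.sqrt_nonneg _), Real.sq_sqrt (h0 _)]
    using integral_abs_le_sqrt_integral_sq hm

lemma IsIncrement.condExp_eq_zero {𝒢 : MeasurableSpace Ω} {δ : ℝ} {Y w : Ω → ℝ}
    (hY : IsIncrement μ 𝒢 δ Y w) (h𝒢 : 𝒢 ≤ m) : μ[Y | 𝒢] =ᵐ[μ] 0 := by
  refine (ae_eq_condExp_of_forall_setIntegral_eq h𝒢 hY.integrable
    (fun _ _ _ => integrableOn_zero) (fun s hs _ => ?_)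
    stronglyMeasurable_zero.aestronglyMeasurable).symm
  have h := hY.integral_mul (s.indicator fun _ => 1) 1 (stronglyMeasurable_const.indicator hs)
    fun ω => by by_cases h : ω ∈ s <;> simp [h]
  have e (ω : Ω) : s.indicator (fun _ => (1 : ℝ)) ω * Y ω = s.indicator Y ω := by
    by_cases h : ω ∈ s <;> simp [h]
  simp_rw [e] at h
  rw [integral_indicator (h𝒢 s hs)] at h
  simpa using h.symm

lemma IsIncrement.integral_mul_of_integrable {𝒢 : MeasurableSpace Ω} {δ : ℝ} {f Y w : Ω → ℝ}
    (hY : IsIncrement μ 𝒢 δ Y w) (h𝒢 : 𝒢 ≤ m) (hf : StronglyMeasurable[𝒢] f)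
    (hfY : Integrable (fun ω => f ω * Y ω) μ) : ∫ ω, f ω * Y ω ∂μ = 0 := by
  rw [← integral_condExp h𝒢]
  refine integral_eq_zero_of_ae ?_
  filter_upwards [condExp_mul_of_stronglyMeasurable_left hf hfY hY.integrable,
    hY.condExp_eq_zero h𝒢] with ω h1 h2
  simp only [Pi.mul_apply, h2, Pi.zero_apply, mul_zero] at h1
  exact h1

lemma integral_sum_sq_eq {ℱ : Filtration ℕ m} {δ : ℝ} {ξ w : ℕ → Ω → ℝ} {n : ℕ}
    (hξm : ∀ k < n, StronglyMeasurable[ℱ (k + 1)] (ξ k))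
    (hξ : ∀ k < n, IsIncrement μ (ℱ k) δ (ξ k) (w k)) :
    ∫ ω, (∑ k ∈ range n, ξ k ω) ^ 2 ∂μ = ∑ k ∈ range n, ∫ ω, w k ω ∂μ := by
  have hL {k : ℕ} (hk : k < n) : MemLp (ξ k) 2 μ := (hξ k hk).memLp.mono_exponent (by norm_num)
  suffices ∀ l ≤ n, ∫ ω, (∑ k ∈ range l, ξ k ω) ^ 2 ∂μ = ∑ k ∈ range l, ∫ ω, w k ω ∂μ from
    this n le_rfl
  intro l
  induction l with
  | zero => simp
  | succ l ih =>
    intro hl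
    have hS : MemLp (fun ω => ∑ k ∈ range l, ξ k ω) 2 μ :=
      memLp_finsetSum _ fun k hk => hL ((mem_range.1 hk).trans hl)
    have hi := hξ l hl
    have hmul : Integrable (fun ω => (∑ k ∈ range l, ξ k ω) * ξ l ω) μ := hS.integrable_mul (hL hl)
    have hcross := hi.integral_mul_of_integrable (ℱ.le l)
      (stronglyMeasurable_sum_range hξm (Nat.le_of_lt hl) le_rfl) hmul
    have hvar := hi.integral_mul_sq (fun _ => 1) 1 stronglyMeasurable_const (by simp)
    simp only [one_mul] at hvar
    rw [sum_range_succ _ l, ← ih (Nat.le_of_lt hl), ← hvar]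
    have e (ω : Ω) : (∑ k ∈ range (l + 1), ξ k ω) ^ 2 = (∑ k ∈ range l, ξ k ω) ^ 2
        + 2 * ((∑ k ∈ range l, ξ k ω) * ξ l ω) + ξ l ω ^ 2 := by rw [sum_range_succ]; ring
    simp_rw [e]
    have hadd : Integrable (fun ω => (∑ k ∈ range l, ξ k ω) ^ 2
        + 2 * ((∑ k ∈ range l, ξ k ω) * ξ l ω)) μ := hS.integrable_sq.add (hmul.const_mul 2)
    rw [integral_add hadd hi.integrable_sq,
      integral_add hS.integrable_sq (hmul.const_mul 2), integral_const_mul, hcross]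
    simp

end SecondMoment

lemma sqrt_add_le_sqrt_add_sqrt {x y : ℝ} (hx : 0 ≤ x) (hy : 0 ≤ y) : √(x + y) ≤ √x + √y := by
  simpa only [Real.sqrt_eq_rpow] using
    Real.rpow_add_le_add_rpow hx hy (by norm_num : (0 : ℝ) ≤ 1 / 2) (by norm_num)

/-- The Wasserstein bound for martingales with bounded conditional variances, not normalised. -/
lemma abs_integral_comp_sum_sub_le {Ω : Type*} {m : MeasurableSpace Ω} {μ : Measure Ω}
    [IsProbabilityMeasure μ] {ℱ : Filtration ℕ m} {δ : ℝ} {Y v : ℕ → Ω → ℝ} {n : ℕ} (hδ : 0 ≤ δ)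
    (hYm : ∀ k < n, StronglyMeasurable[ℱ (k + 1)] (Y k))
    (hY : ∀ k < n, IsIncrement μ (ℱ k) δ (Y k) (v k)) {B : ℝ} (hB : 0 < B)
    (hvB : ∀ k < n, ∀ ω, v k ω ≤ B ^ 2) {s : ℝ} (hs : 0 < s)
    (hs2 : s ^ 2 = ∑ k ∈ range n, ∫ ω, v k ω ∂μ) {h : ℝ → ℝ} (hh : LipschitzWith 1 h) :
    |∫ ω, h (∑ k ∈ range n, Y k ω) ∂μ - ∫ z, h (s * z) ∂stdNormal|
      ≤ 2 * √((∫ ω, |∑ k ∈ range n, v k ω - s ^ 2| ∂μ) / 2) + (1 + √3 + √2) * B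
        + 3 * δ * (log (s ^ 2 + B ^ 2) - log (B ^ 2)) := by
  set V : Ω → ℝ := fun ω => ∑ k ∈ range n, v k ω with hV
  set D := ∫ ω, |V ω - s ^ 2| ∂μ with hD
  set e : ℕ → Set Ω := fun k => {ω | ∑ i ∈ range (k + 1), v i ω ≤ s ^ 2} with he
  have hem (k : ℕ) (hk : k < n) : MeasurableSet[ℱ k] (e k) :=
    measurableSet_le (stronglyMeasurable_sum_range (j := 0)
      (fun k hk => (hY k hk).stronglyMeasurable) hk le_rfl).measurable measurable_const
  set ξ : ℕ → Ω → ℝ := fun k => (e k).indicator (Y k) with hξd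
  set w : ℕ → Ω → ℝ := fun k => (e k).indicator (v k) with hwd
  set η : ℕ → Ω → ℝ := fun k => (e k)ᶜ.indicator (Y k) with hηd
  set u : ℕ → Ω → ℝ := fun k => (e k)ᶜ.indicator (v k) with hud
  have hξ (k : ℕ) (hk : k < n) : IsIncrement μ (ℱ k) δ (ξ k) (w k) :=
    (hY k hk).indicator (ℱ.le k) (hem k hk)
  have hη (k : ℕ) (hk : k < n) : IsIncrement μ (ℱ k) δ (η k) (u k) :=
    (hY k hk).indicator (ℱ.le k) (hem k hk).compl
  have hξm (k : ℕ) (hk : k < n) : StronglyMeasurable[ℱ (k + 1)] (ξ k) :=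
    (hYm k hk).indicator (ℱ.mono k.le_succ _ (hem k hk))
  have hηm (k : ℕ) (hk : k < n) : StronglyMeasurable[ℱ (k + 1)] (η k) :=
    (hYm k hk).indicator (ℱ.mono k.le_succ _ (hem k hk).compl)
  have hwB (k : ℕ) (hk : k < n) (ω : Ω) : w k ω ≤ B ^ 2 :=
    (Set.indicator_le_self' (fun ω _ => (hY k hk).nonneg ω) ω).trans (hvB k hk ω)
  have hwi (k : ℕ) (ω : Ω) : w k ω = if ∑ i ∈ range (k + 1), v i ω ≤ s ^ 2 then v k ω else 0 := by
    simp only [hwd, he, Set.indicator_apply, Set.mem_ofPred_eq]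
  set W : Ω → ℝ := fun ω => ∑ k ∈ range n, w k ω with hW
  have hbounds (ω : Ω) : W ω ≤ s ^ 2 ∧ (V ω ≤ s ^ 2 → W ω = V ω)
      ∧ (s ^ 2 < V ω → s ^ 2 - B ^ 2 ≤ W ω) := by
    simp only [hW, hwi, hV]
    exact sum_stopped_bounds (sq_nonneg s) (fun k hk => (hY k hk).nonneg ω)
      fun k hk => hvB k hk ω
  have hVi : Integrable V μ :=
    integrable_finsetSum _ fun k hk => (hY k (mem_range.1 hk)).integrable_var (ℱ.le k)
  have hWi : Integrable W μ :=
    integrable_finsetSum _ fun k hk => (hξ k (mem_range.1 hk)).integrable_var (ℱ.le k)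
  have hEV : ∫ ω, V ω ∂μ = s ^ 2 := by
    rw [hs2]
    exact integral_finsetSum _ fun k hk => (hY k (mem_range.1 hk)).integrable_var (ℱ.le k)
  have hdi : Integrable (fun ω => V ω - s ^ 2) μ := hVi.sub (integrable_const _)
  have hd0 : ∫ ω, (V ω - s ^ 2) ∂μ = 0 := by
    rw [integral_sub hVi (integrable_const _), hEV]; simp
  have hB2 := sq_nonneg B
  have hdm : Integrable (fun ω => (|V ω - s ^ 2| - (V ω - s ^ 2)) / 2) μ :=
    (hdi.abs.sub hdi).div_const 2
  have hWI : ∫ ω, (s ^ 2 - W ω) ∂μ ≤ D / 2 + B ^ 2 := by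
    have h1 : ∫ ω, (s ^ 2 - W ω) ∂μ ≤ ∫ ω, ((|V ω - s ^ 2| - (V ω - s ^ 2)) / 2 + B ^ 2) ∂μ := by
      refine integral_mono ((integrable_const _).sub hWi) (hdm.add (integrable_const _))
        fun ω => ?_
      obtain ⟨-, h2, h3⟩ := hbounds ω
      rcases le_or_gt (V ω) (s ^ 2) with h | h
      · simp only [h2 h, abs_of_nonpos (sub_nonpos.2 h)]; linarith
      · have := h3 h
        simp only [abs_of_pos (sub_pos.2 h)]; linarith
    refine h1.trans_eq ?_
    rw [integral_add hdm (integrable_const _), integral_div, integral_sub hdi.abs hdi, hd0]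
    simp [hD]
  have hUI : ∫ ω, (V ω - W ω) ∂μ ≤ D / 2 + B ^ 2 := by
    rw [integral_sub hVi hWi, hEV]
    rwa [integral_sub (integrable_const _) hWi, integral_const, probReal_univ, one_smul] at hWI
  have hsplit (k : ℕ) (ω : Ω) : Y k ω = ξ k ω + η k ω :=
    (Set.indicator_self_add_compl_apply (e k) (Y k) ω).symm
  have hsplitv (k : ℕ) (ω : Ω) : v k ω = w k ω + u k ω :=
    (Set.indicator_self_add_compl_apply (e k) (v k) ω).symm
  have hξi : Integrable (fun ω => ∑ k ∈ range n, ξ k ω) μ :=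
    integrable_finsetSum _ fun k hk => (hξ k (mem_range.1 hk)).integrable
  have hYi : Integrable (fun ω => ∑ k ∈ range n, Y k ω) μ :=
    integrable_finsetSum _ fun k hk => (hY k (mem_range.1 hk)).integrable
  have hηL : MemLp (fun ω => ∑ k ∈ range n, η k ω) 2 μ :=
    memLp_finsetSum _ fun k hk => (hη k (mem_range.1 hk)).memLp.mono_exponent (by norm_num)
  have hcomp {x : Ω → ℝ} (hx : Integrable x μ) : Integrable (fun ω => h (x ω)) μ := by
    simpa only [gaussSmooth_one_zero] using
      integrable_gaussSmooth_one_comp hh (aestronglyMeasurable_const (b := (0 : ℝ))) hx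
        (b := 0) (by simp)
  have b1 : |∫ ω, h (∑ k ∈ range n, Y k ω) ∂μ - ∫ ω, h (∑ k ∈ range n, ξ k ω) ∂μ|
      ≤ √(D / 2 + B ^ 2) := by
    rw [← integral_sub (hcomp hYi) (hcomp hξi), ← Real.norm_eq_abs]
    refine (norm_integral_le_of_norm_le (hηL.integrable (by norm_num)).abs
      (Filter.Eventually.of_forall fun ω => ?_)).trans
      ((integral_abs_le_sqrt_integral_sq hηL).trans (Real.sqrt_le_sqrt ?_))
    · have := hh.dist_le_mul (∑ k ∈ range n, Y k ω) (∑ k ∈ range n, ξ k ω)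
      simpa [Real.dist_eq, hsplit, sum_add_distrib] using this
    · rw [integral_sum_sq_eq hηm hη, ← integral_finsetSum _ fun k hk =>
        (hη k (mem_range.1 hk)).integrable_var (ℱ.le k)]
      refine le_of_eq_of_le (integral_congr_ae (Filter.Eventually.of_forall fun ω => ?_)) hUI
      simp [hV, hW, hsplitv, sum_add_distrib]
  have hr0 (ω : Ω) : 0 ≤ s ^ 2 - W ω := sub_nonneg.2 (hbounds ω).1
  have hW0 (ω : Ω) : 0 ≤ W ω := sum_nonneg fun k hk => (hξ k (mem_range.1 hk)).nonneg ω
  have hrest : Integrable (fun ω => s ^ 2 - W ω) μ := (integrable_const _).sub hWi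
  have hri : Integrable (fun ω => s ^ 2 - W ω + 2 * B ^ 2) μ := hrest.add (integrable_const _)
  have hsm : AEStronglyMeasurable (fun ω => √(s ^ 2 - W ω + 2 * B ^ 2)) μ :=
    Real.continuous_sqrt.comp_aestronglyMeasurable hri.aestronglyMeasurable
  have hsb (ω : Ω) : |√(s ^ 2 - W ω + 2 * B ^ 2)| ≤ √(s ^ 2 + 2 * B ^ 2) := by
    rw [abs_of_nonneg (Real.sqrt_nonneg _)]
    exact Real.sqrt_le_sqrt (by linarith [hW0 ω])
  have hsi : Integrable (fun ω => √(s ^ 2 - W ω + 2 * B ^ 2)) μ :=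
    (integrable_const _).mono' hsm (Filter.Eventually.of_forall hsb)
  have hg := integrable_gaussSmooth_one_comp hh hsm hξi hsb
  have b2 : |∫ ω, h (∑ k ∈ range n, ξ k ω) ∂μ
      - ∫ ω, gaussSmooth h (fun _ => 1) √(s ^ 2 - W ω + 2 * B ^ 2) (∑ k ∈ range n, ξ k ω) ∂μ|
      ≤ √(D / 2 + 3 * B ^ 2) := by
    rw [abs_sub_comm, ← integral_sub hg (hcomp hξi), ← Real.norm_eq_abs]
    refine (norm_integral_le_of_norm_le hsi
      (Filter.Eventually.of_forall fun ω => ?_)).trans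
      ((integral_sqrt_le hri fun ω => by linarith [hr0 ω]).trans (Real.sqrt_le_sqrt ?_))
    · have := abs_gaussSmooth_one_sub_le hh √(s ^ 2 - W ω + 2 * B ^ 2) 0 (∑ k ∈ range n, ξ k ω)
      rwa [gaussSmooth_one_zero, sub_zero, abs_of_nonneg (Real.sqrt_nonneg _)] at this
    · rw [integral_add hrest (integrable_const _), integral_const, probReal_univ, one_smul]
      linarith
  have b3 := abs_integral_gaussSmooth_martingale_le hδ hξm hξ hB hwB
    (fun ω => (hbounds ω).1) hh le_rfl
  have b3' : ∫ ω, (log (s ^ 2 + B ^ 2) - log (s ^ 2 - W ω + B ^ 2)) ∂μ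
      ≤ log (s ^ 2 + B ^ 2) - log (B ^ 2) := by
    refine (integral_mono_of_nonneg (Filter.Eventually.of_forall fun ω => ?_)
      (integrable_const _) (Filter.Eventually.of_forall fun ω => ?_)).trans_eq
      (by rw [integral_const, probReal_univ, one_smul])
    · have := hr0 ω
      exact sub_nonneg.2 (log_le_log (by positivity) (by linarith [hW0 ω]))
    · exact sub_le_sub_left (log_le_log (by positivity) (by linarith [hr0 ω])) _
  have b4 : |gaussSmooth h (fun _ => 1) √(s ^ 2 + 2 * B ^ 2) 0 - ∫ z, h (s * z) ∂stdNormal|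
      ≤ √2 * B := by
    have e : ∫ z, h (s * z) ∂stdNormal = gaussSmooth h (fun _ => 1) s 0 := by
      simp [gaussSmooth]
    rw [e]
    refine (abs_gaussSmooth_one_sub_le hh _ _ _).trans ?_
    have h1 : s ≤ √(s ^ 2 + 2 * B ^ 2) := Real.le_sqrt_of_sq_le (by linarith)
    rw [abs_of_nonneg (sub_nonneg.2 h1), sub_le_iff_le_add', Real.sqrt_le_left (by positivity)]
    nlinarith [Real.sq_sqrt zero_le_two, mul_pos hs hB, Real.sqrt_nonneg 2,
      mul_nonneg (mul_pos hs hB).le (Real.sqrt_nonneg 2)]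
  have hD0 : 0 ≤ D / 2 := div_nonneg (integral_nonneg fun ω => abs_nonneg _) zero_le_two
  have s1 : √(D / 2 + B ^ 2) ≤ √(D / 2) + B := by
    simpa [Real.sqrt_sq hB.le] using sqrt_add_le_sqrt_add_sqrt hD0 (sq_nonneg B)
  have s2 : √(D / 2 + 3 * B ^ 2) ≤ √(D / 2) + √3 * B := by
    simpa [Real.sqrt_sq hB.le] using
      sqrt_add_le_sqrt_add_sqrt hD0 (by positivity : 0 ≤ 3 * B ^ 2)
  have b3'' := b3.trans (mul_le_mul_of_nonneg_left b3' (by positivity : 0 ≤ 3 * δ))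
  rw [abs_le] at *
  constructor <;> linarith [b1.1, b1.2, b2.1, b2.2, b3''.1, b3''.2, b4.1, b4.2]

lemma memLp_three_of_integrable_abs_cube {Ω : Type*} {m : MeasurableSpace Ω} {μ : Measure Ω}
    {Y : Ω → ℝ} (hYm : AEStronglyMeasurable Y μ) (hY3 : Integrable (fun ω => |Y ω| ^ 3) μ) :
    MemLp Y 3 μ := by
  rw [← integrable_norm_rpow_iff hYm (by norm_num) (by norm_num)]
  refine hY3.congr (Filter.Eventually.of_forall fun ω => ?_)
  simp only [Real.norm_eq_abs, ENNReal.toReal_ofNat]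
  exact (Real.rpow_natCast _ 3).symm

section CondExp

variable {Ω : Type*} {𝒢 m : MeasurableSpace Ω} {μ : Measure Ω} [IsProbabilityMeasure μ]
  {Y : Ω → ℝ}

/-- Conditional form of the inequality `x² ≤ 2|x|³ / (3c) + c² / 3`. -/
lemma condExp_sq_le_condExp_abs_cube (hY : MemLp Y 3 μ) {c : ℝ} (hc : 0 < c) :
    μ[fun ω => Y ω ^ 2 | 𝒢] ≤ᵐ[μ]
      fun ω => 2 / (3 * c) * μ[fun ω => |Y ω| ^ 3 | 𝒢] ω + c ^ 2 / 3 := by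
  by_cases h𝒢 : 𝒢 ≤ m
  swap
  · simp only [condExp_of_not_le h𝒢]
    exact Filter.Eventually.of_forall fun ω => by simp; positivity
  have h3 : Integrable (fun ω => |Y ω| ^ 3) μ := by
    simpa using hY.integrable_norm_pow (p := 3) (by norm_num)
  have h2 : Integrable (fun ω => Y ω ^ 2) μ := (hY.mono_exponent (by norm_num)).integrable_sq
  have h3c : Integrable ((2 / (3 * c)) • fun ω => |Y ω| ^ 3) μ := h3.smul _
  have hle : (fun ω => Y ω ^ 2) ≤ᵐ[μ]
      ((2 / (3 * c)) • fun ω => |Y ω| ^ 3) + fun _ => c ^ 2 / 3 := by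
    refine Filter.Eventually.of_forall fun ω => ?_
    simp only [Pi.add_apply, Pi.smul_apply, smul_eq_mul]
    rw [← sq_abs]
    have : 0 ≤ (|Y ω| - c) ^ 2 * (2 * |Y ω| + c) / (3 * c) := by positivity
    have e : 2 / (3 * c) * |Y ω| ^ 3 + c ^ 2 / 3 - |Y ω| ^ 2
        = (|Y ω| - c) ^ 2 * (2 * |Y ω| + c) / (3 * c) := by
      field_simp
      ring
    linarith
  filter_upwards [condExp_mono (m := 𝒢) h2 (h3c.add (integrable_const _)) hle,
    condExp_add h3c (integrable_const (c ^ 2 / 3)) 𝒢,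
    condExp_smul (μ := μ) (2 / (3 * c)) (fun ω => |Y ω| ^ 3) 𝒢] with ω h1 h2 h3
  rw [h2, Pi.add_apply, h3, condExp_const h𝒢] at h1
  exact h1

lemma IsIncrement.of_condExp {δ : ℝ} {w : Ω → ℝ} (h𝒢 : 𝒢 ≤ m) (hY : MemLp Y 3 μ)
    (hmean : μ[Y | 𝒢] =ᵐ[μ] 0) (hw : StronglyMeasurable[𝒢] w) (h0 : ∀ ω, 0 ≤ w ω)
    (hwδ : ∀ ω, w ω ≤ δ ^ 2) (hvar : μ[fun ω => Y ω ^ 2 | 𝒢] =ᵐ[μ] w)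
    (hcube : μ[fun ω => |Y ω| ^ 3 | 𝒢] ≤ᵐ[μ] fun ω => δ * w ω) : IsIncrement μ 𝒢 δ Y w := by
  have h1 : Integrable Y μ := hY.integrable (by norm_num)
  have h2 : Integrable (fun ω => Y ω ^ 2) μ := (hY.mono_exponent (by norm_num)).integrable_sq
  have h3 : Integrable (fun ω => |Y ω| ^ 3) μ := by
    simpa using hY.integrable_norm_pow (p := 3) (by norm_num)
  have pull {f g : Ω → ℝ} {C : ℝ} (hg : Integrable g μ) (hf : StronglyMeasurable[𝒢] f)
      (hC : ∀ ω, |f ω| ≤ C) : ∫ ω, f ω * g ω ∂μ = ∫ ω, f ω * μ[g | 𝒢] ω ∂μ := by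
    rw [← integral_condExp h𝒢]
    exact integral_congr_ae (condExp_stronglyMeasurable_mul_of_bound h𝒢 hf hg C
      (Filter.Eventually.of_forall hC))
  refine ⟨hY, hw, h0, hwδ, fun f C hf hC => ?_, fun f C hf hC => ?_, fun f C hf hC hf0 => ?_⟩
  · rw [pull h1 hf hC]
    refine integral_eq_zero_of_ae ?_
    filter_upwards [hmean] with ω h
    simp [h]
  · rw [pull h2 hf hC]
    refine integral_congr_ae ?_
    filter_upwards [hvar] with ω h
    rw [h]
  · have hwi : Integrable w μ := integrable_condExp.congr hvar
    rw [pull h3 hf hC, ← integral_const_mul]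
    refine integral_mono_ae
      (integrable_condExp.bdd_mul (hf.mono h𝒢).aestronglyMeasurable
        (Filter.Eventually.of_forall hC))
      ((hwi.bdd_mul (hf.mono h𝒢).aestronglyMeasurable
        (Filter.Eventually.of_forall hC)).const_mul δ) ?_
    filter_upwards [hcube] with ω h
    have := mul_le_mul_of_nonneg_left h (hf0 ω)
    linarith

/-- A version of the conditional variance which is bounded everywhere. -/
lemma exists_isIncrement {β δ : ℝ} (hβ : 0 < β) (hδ : 0 < δ) (h𝒢 : 𝒢 ≤ m) (hY : MemLp Y 3 μ)
    (hmean : μ[Y | 𝒢] =ᵐ[μ] 0)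
    (hcube : μ[fun ω => |Y ω| ^ 3 | 𝒢] ≤ᵐ[μ]
      fun ω => min β (δ * μ[fun ω => Y ω ^ 2 | 𝒢] ω)) :
    ∃ w, IsIncrement μ 𝒢 δ Y w ∧ (∀ ω, w ω ≤ (β ^ ((1 : ℝ) / 3)) ^ 2) ∧
      μ[fun ω => Y ω ^ 2 | 𝒢] =ᵐ[μ] w := by
  set B := β ^ ((1 : ℝ) / 3) with hBd
  have hB : 0 < B := Real.rpow_pos_of_pos hβ _
  have hB3 : β = B ^ 3 := by
    rw [hBd, ← Real.rpow_natCast, ← Real.rpow_mul hβ.le]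
    norm_num
  set σ := μ[fun ω => Y ω ^ 2 | 𝒢] with hσ
  set w : Ω → ℝ := fun ω => max 0 (min (σ ω) (min (B ^ 2) (δ ^ 2))) with hwd
  have hσm : StronglyMeasurable[𝒢] σ := stronglyMeasurable_condExp
  have hw : StronglyMeasurable[𝒢] w :=
    (measurable_const.max (hσm.measurable.min measurable_const)).stronglyMeasurable
  have hwe : σ =ᵐ[μ] w := by
    have hpos : 0 ≤ᵐ[μ] σ :=
      condExp_nonneg (Filter.Eventually.of_forall fun ω => sq_nonneg (Y ω))
    filter_upwards [hpos, hcube, condExp_sq_le_condExp_abs_cube (𝒢 := 𝒢) hY hB,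
      condExp_sq_le_condExp_abs_cube (𝒢 := 𝒢) hY hδ] with ω h0 h1 h2 h3
    have hb : σ ω ≤ B ^ 2 := by
      have := mul_le_mul_of_nonneg_left (h1.trans (min_le_left _ _))
        (by positivity : 0 ≤ 2 / (3 * B))
      rw [hB3] at this
      have e : 2 / (3 * B) * B ^ 3 = 2 / 3 * B ^ 2 := by field_simp
      linarith
    have hd : σ ω ≤ δ ^ 2 := by
      have := mul_le_mul_of_nonneg_left (h1.trans (min_le_right _ _))
        (by positivity : 0 ≤ 2 / (3 * δ))
      have e : 2 / (3 * δ) * (δ * σ ω) = 2 / 3 * σ ω := by field_simp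
      linarith
    rw [hwd]
    beta_reduce
    rw [min_eq_left (le_min hb hd), max_eq_right (by simpa using h0)]
  refine ⟨w, IsIncrement.of_condExp h𝒢 hY hmean hw (fun ω => le_max_left _ _)
    (fun ω => max_le (sq_nonneg δ) ((min_le_right _ _).trans (min_le_right _ _))) hwe ?_,
    fun ω => max_le (sq_nonneg B) ((min_le_right _ _).trans (min_le_left _ _)), hwe⟩
  filter_upwards [hcube, hwe] with ω h1 h2
  rw [← h2]
  exact h1.trans (min_le_right _ _)

lemma pos_of_condExp_abs_cube_le {β δ : ℝ} (h𝒢 : 𝒢 ≤ m) (hY : MemLp Y 3 μ)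
    (hcube : μ[fun ω => |Y ω| ^ 3 | 𝒢] ≤ᵐ[μ]
      fun ω => min β (δ * μ[fun ω => Y ω ^ 2 | 𝒢] ω))
    (hpos : ∫ ω, Y ω ^ 2 ∂μ ≠ 0) : 0 < β ∧ 0 < δ := by
  have h3 : Integrable (fun ω => |Y ω| ^ 3) μ := by
    simpa using hY.integrable_norm_pow (p := 3) (by norm_num)
  have hc : 0 < ∫ ω, |Y ω| ^ 3 ∂μ := by
    refine (integral_nonneg fun ω => by positivity).lt_of_ne' fun h => hpos ?_
    rw [integral_eq_zero_iff_of_nonneg (fun ω => by positivity) h3] at h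
    refine integral_eq_zero_of_ae ?_
    filter_upwards [h] with ω h
    simpa using h
  have h2 : 0 ≤ ∫ ω, Y ω ^ 2 ∂μ := integral_nonneg fun ω => sq_nonneg _
  constructor
  · have := integral_mono_ae integrable_condExp (integrable_const β)
      (hcube.mono fun ω h => h.trans (min_le_left _ _))
    rw [integral_condExp h𝒢, integral_const, probReal_univ, one_smul] at this
    exact hc.trans_le this
  · have := integral_mono_ae integrable_condExp (integrable_condExp.const_mul δ)
      (hcube.mono fun ω h => h.trans (min_le_right _ _))
    rw [integral_condExp h𝒢, integral_const_mul, integral_condExp h𝒢] at this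
    exact pos_of_mul_pos_left (hc.trans_le this) h2

end CondExp

/-- Comparison of the error terms with those of the normalised bound. -/
lemma error_bound_le {n : ℕ} (hn : 1 ≤ n) {B δ s D : ℝ} (hB : 0 < B) (hs : 0 < s)
    (hsB : s ^ 2 ≤ n * B ^ 2) :
    (2 * √(D / 2) + (1 + √3 + √2) * B + 3 * δ * (log (s ^ 2 + B ^ 2) - log (B ^ 2))) / s
      ≤ 1.5 * √(D / s ^ 2)
        + 3 * n * max (1.6 * B) δ * (s ^ 2 / n + 1.4 * B ^ 2) * (1 + log n) / s ^ 3 := by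
  have hn1 : (1 : ℝ) ≤ n := by exact_mod_cast hn
  have hn0 : (0 : ℝ) < n := by linarith
  have hlog : log (s ^ 2 + B ^ 2) - log (B ^ 2) ≤ 1 + log n := by
    rw [← log_div (by positivity) (by positivity)]
    have h1 : (s ^ 2 + B ^ 2) / B ^ 2 ≤ 2 * n := by
      rw [div_le_iff₀ (by positivity)]
      nlinarith [sq_nonneg B]
    refine (log_le_log (by positivity) h1).trans ?_
    rw [log_mul two_ne_zero hn0.ne']
    linarith [log_two_lt_d9]
  set L := 1 + log n with hL
  have hL1 : 1 ≤ L := by linarith [log_nonneg hn1]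
  set M := max (1.6 * B) δ with hM
  have hMB : 1.6 * B ≤ M := le_max_left _ _
  have hMδ : δ ≤ M := le_max_right _ _
  have h2 : √2 < 1.415 := by rw [Real.sqrt_lt' (by norm_num)]; norm_num
  have h3 : √3 < 1.733 := by rw [Real.sqrt_lt' (by norm_num)]; norm_num
  have e1 : 2 * √(D / 2) = √2 * √D := by
    rw [Real.sqrt_div' _ zero_le_two, mul_div_left_comm, mul_comm]
    congr 1
    rw [div_eq_iff (by positivity), Real.mul_self_sqrt zero_le_two]
  have e2 : 3 * n * M * (s ^ 2 / n + 1.4 * B ^ 2) * L / s ^ 3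
      = 3 * M * L * (1 + 1.4 * (n * B ^ 2 / s ^ 2)) / s := by
    field_simp
  rw [Real.sqrt_div' _ (sq_nonneg s), Real.sqrt_sq hs.le, e2, ← mul_div_assoc, ← add_div, e1]
  refine div_le_div_of_nonneg_right ?_ hs.le
  have hq : 1 ≤ n * B ^ 2 / s ^ 2 := (one_le_div (by positivity)).2 hsB
  have t1 : √2 * √D ≤ 1.5 * √D :=
    mul_le_mul_of_nonneg_right (by linarith) (Real.sqrt_nonneg D)
  have t2 : 3 * δ * (log (s ^ 2 + B ^ 2) - log (B ^ 2)) ≤ 3 * M * L :=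
    mul_le_mul (by linarith) hlog
      (sub_nonneg.2 (log_le_log (by positivity) (by linarith [sq_nonneg s]))) (by linarith)
  have t3 : 1.6 * B ≤ M * L * (n * B ^ 2 / s ^ 2) := by
    calc 1.6 * B ≤ M := hMB
      _ ≤ M * L := le_mul_of_one_le_right (by linarith) hL1
      _ ≤ _ := le_mul_of_one_le_right (by nlinarith) hq
  have t4 : (1 + √3 + √2) * B ≤ 4.2 * (1.6 * B) := by nlinarith
  linarith

/-- **Corollary 3** (Röllin): if the conditional third moments satisfy
`E(|X_k|³|F_{k-1}) ≤ min(β, δσ_k²)` a.s. (no constraint on `V_n²`), then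
`d_W(L(S_n/s_n), N(0,1)) ≤ 1.5 (E|V_n²/s_n² − 1|)^{1/2}
  + 3n max(1.6β^{1/3}, δ)(s_n²/n + 1.4β^{2/3})(1 + log n)/s_n³ + 2/√n`. -/
theorem mean_martingale_clt_wasserstein_general
    {Ω : Type*} [m : MeasurableSpace Ω] {μ : Measure Ω} [IsProbabilityMeasure μ]
    (n : ℕ) (hn : 1 ≤ n)
    (ℱ : Filtration ℕ m)
    (X : ℕ → Ω → ℝ)
    -- martingale difference sequence:
    (hadp : ∀ k, 1 ≤ k → k ≤ n → StronglyMeasurable[ℱ k] (X k))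
    (hint : ∀ k, 1 ≤ k → k ≤ n → Integrable (X k) μ)
    (hmds : ∀ k, 1 ≤ k → k ≤ n → μ[X k | ℱ (k - 1)] =ᵐ[μ] 0)
    -- finite third moments:
    (hX3 : ∀ k, 1 ≤ k → k ≤ n → Integrable (fun ω => |X k ω| ^ 3) μ)
    -- conditional variances σ_k² = E(X_k²|F_{k-1}):
    (σ2 : ℕ → Ω → ℝ)
    (hσ2 : ∀ k, σ2 k = μ[fun ω => (X k ω) ^ 2 | ℱ (k - 1)])
    -- s_n² = Var S_n = ∑ E X_i²:
    (sn : ℝ) (hsn : 0 < sn)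
    (hsn2 : sn ^ 2 = ∑ i ∈ Icc 1 n, ∫ ω, (X i ω) ^ 2 ∂μ)
    -- conditional third moment bound E(|X_k|³|F_{k-1}) ≤ β ∧ δσ_k²:
    (β δ : ℝ)
    (hβδ : ∀ k, 1 ≤ k → k ≤ n →
      μ[fun ω => |X k ω| ^ 3 | ℱ (k - 1)] ≤ᵐ[μ] fun ω => min β (δ * σ2 k ω))
    (h : ℝ → ℝ) (hh : LipschitzWith 1 h) :
    |(∫ ω, h ((∑ i ∈ Icc 1 n, X i ω) / sn) ∂μ) - ∫ x, h x ∂(gaussianReal 0 1)|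
      ≤ 1.5 * Real.sqrt (∫ ω, |(∑ i ∈ Icc 1 n, σ2 i ω) / sn ^ 2 - 1| ∂μ)
        + 3 * n * max (1.6 * β ^ ((1 : ℝ) / 3)) δ * (sn ^ 2 / n + 1.4 * β ^ ((2 : ℝ) / 3))
            * (1 + Real.log n) / sn ^ 3
        + 2 / Real.sqrt n := by
  have hk (j : ℕ) (hj : j < n) : 1 ≤ j + 1 ∧ j + 1 ≤ n := ⟨by omega, hj⟩
  have hsum (f : ℕ → ℝ) : ∑ i ∈ Icc 1 n, f i = ∑ j ∈ range n, f (j + 1) := by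
    rw [← Ico_add_one_right_eq_Icc, sum_Ico_eq_sum_range]
    simp [add_comm]
  have hL (j : ℕ) (hj : j < n) : MemLp (X (j + 1)) 3 μ :=
    memLp_three_of_integrable_abs_cube (hint _ (hk j hj).1 (hk j hj).2).aestronglyMeasurable
      (hX3 _ (hk j hj).1 (hk j hj).2)
  have hmean (j : ℕ) (hj : j < n) : μ[X (j + 1) | ℱ j] =ᵐ[μ] 0 :=
    hmds _ (hk j hj).1 (hk j hj).2
  have hσ (j : ℕ) : σ2 (j + 1) = μ[fun ω => X (j + 1) ω ^ 2 | ℱ j] := hσ2 (j + 1)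
  have hcube (j : ℕ) (hj : j < n) : μ[fun ω => |X (j + 1) ω| ^ 3 | ℱ j] ≤ᵐ[μ]
      fun ω => min β (δ * μ[fun ω => X (j + 1) ω ^ 2 | ℱ j] ω) := by
    rw [← hσ]
    exact hβδ _ (hk j hj).1 (hk j hj).2
  rw [hsum] at hsn2
  obtain ⟨hβ, hδ⟩ : 0 < β ∧ 0 < δ := by
    obtain ⟨j, hj, h0⟩ := exists_ne_zero_of_sum_ne_zero (hsn2 ▸ (pow_pos hsn 2).ne')
    have hj := mem_range.1 hj
    exact pos_of_condExp_abs_cube_le (ℱ.le j) (hL j hj) (hcube j hj) h0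
  choose! v hv hvB hvσ using fun j (hj : j < n) =>
    exists_isIncrement hβ hδ (ℱ.le j) (hL j hj) (hmean j hj) (hcube j hj)
  set B := β ^ ((1 : ℝ) / 3) with hBd
  have hB : 0 < B := Real.rpow_pos_of_pos hβ _
  have hB2 : β ^ ((2 : ℝ) / 3) = B ^ 2 := by
    rw [hBd, ← Real.rpow_natCast, ← Real.rpow_mul hβ.le]
    norm_num
  have hs2 : sn ^ 2 = ∑ j ∈ range n, ∫ ω, v j ω ∂μ := by
    rw [hsn2]
    refine sum_congr rfl fun j hj => ?_
    have hj := mem_range.1 hj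
    rw [← integral_condExp (ℱ.le j)]
    exact integral_congr_ae (hvσ j hj)
  have hsB : sn ^ 2 ≤ n * B ^ 2 := by
    rw [hs2]
    refine (sum_le_card_nsmul _ _ (B ^ 2) fun j hj => ?_).trans_eq (by simp)
    have hj := mem_range.1 hj
    have := integral_mono ((hv j hj).integrable_var (ℱ.le j)) (integrable_const (B ^ 2)) (hvB j hj)
    rwa [integral_const, probReal_univ, one_smul] at this
  have hH : LipschitzWith 1 fun x => sn * h (x / sn) := by
    refine LipschitzWith.of_dist_le_mul fun x y => ?_
    have := hh.dist_le_mul (x / sn) (y / sn)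
    simp only [Real.dist_eq, NNReal.coe_one, one_mul, ← sub_div, ← mul_sub, abs_mul, abs_div,
      abs_of_pos hsn] at this ⊢
    rwa [le_div_iff₀' hsn] at this
  have key := abs_integral_comp_sum_sub_le (Y := fun j => X (j + 1)) hδ.le
    (fun j hj => hadp _ (hk j hj).1 (hk j hj).2) hv hB hvB hsn hs2 hH
  have hX (ω : Ω) := hsum fun i => X i ω
  simp_rw [mul_div_cancel_left₀ _ hsn.ne', integral_const_mul, ← mul_sub, abs_mul,
    abs_of_pos hsn, ← hX] at key
  have hD : ∫ ω, |(∑ i ∈ Icc 1 n, σ2 i ω) / sn ^ 2 - 1| ∂μ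
      = (∫ ω, |∑ j ∈ range n, v j ω - sn ^ 2| ∂μ) / sn ^ 2 := by
    rw [← integral_div]
    refine integral_congr_ae ?_
    filter_upwards [(Set.finite_Iio n).eventually_all.2 fun j hj => hvσ j hj] with ω hω
    have e : ∑ i ∈ Icc 1 n, σ2 i ω = ∑ j ∈ range n, v j ω := by
      rw [hsum fun i => σ2 i ω]
      exact sum_congr rfl fun j hj => by rw [hσ, hω j (mem_range.1 hj)]
    rw [e, div_sub_one (by positivity), abs_div, abs_of_pos (pow_pos hsn 2)]
  rw [hD, hB2]
  refine ((le_div_iff₀' hsn).2 key).trans ((error_bound_le hn hB hsn hsB).trans ?_)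
  exact le_add_of_nonneg_right (by positivity)
end

section
/- Let h: ℝ → ℝ be Lipschitz-continuous with Lipschitz constant L, let s ∈ ℝ and t > 0, and let Y ~ N(0,1). Then there exists a differentiable function f: ℝ → ℝ whose derivative f' is Lipschitz such that: (i) t² f'(w) − (w − s) f(w) = h(w) − E[h(tY + s)] for all w ∈ ℝ; (ii) f' is bounded with sup_w |f'(w)| ≤ L/t; and (iii) f' is Lipschitz with constant 2L/t² (i.e., the almost-everywhere second derivative satisfies ‖f''‖_∞ ≤ 2L/t²). -/
open MeasureTheory ProbabilityTheory Real

section Density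

/-- The standard normal density. -/
local notation "φ" => gaussianPDFReal 0 1

lemma stdGaussianPDF_eq (x : ℝ) : φ x = (√(2 * π))⁻¹ * exp (-(1 / 2) * x ^ 2) := by
  rw [gaussianPDFReal]
  congr 2
  · simp
  · simp only [sub_zero, NNReal.coe_one]; ring

lemma stdGaussianPDF_pos (x : ℝ) : 0 < φ x := gaussianPDFReal_pos 0 1 x one_ne_zero

lemma stdGaussianPDF_neg (x : ℝ) : φ (-x) = φ x := by
  simp [stdGaussianPDF_eq]

lemma hasDerivAt_stdGaussianPDF (x : ℝ) : HasDerivAt φ (-(x * φ x)) x := by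
  have h1 : HasDerivAt (fun y : ℝ => -(1 / 2) * y ^ 2) (-x) x := by
    convert! (hasDerivAt_pow 2 x).const_mul (-(1 / 2 : ℝ)) using 1
    simp
  rw [funext stdGaussianPDF_eq]
  convert! h1.exp.const_mul (√(2 * π))⁻¹ using 1
  ring

lemma continuous_stdGaussianPDF : Continuous φ :=
  continuous_iff_continuousAt.2 fun x => (hasDerivAt_stdGaussianPDF x).continuousAt

lemma stdGaussianPDF_le (x : ℝ) : φ x ≤ 2 / 5 := by
  have h1 : (5 / 2 : ℝ) ≤ √(2 * π) := by
    apply Real.le_sqrt_of_sq_le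
    linarith [pi_gt_d2]
  have h2 : (√(2 * π))⁻¹ ≤ 2 / 5 := by
    calc (√(2 * π))⁻¹ ≤ (5 / 2 : ℝ)⁻¹ := inv_anti₀ (by norm_num) h1
      _ = 2 / 5 := by norm_num
  have h3 : exp (-(1 / 2) * x ^ 2) ≤ 1 := exp_le_one_iff.2 (by nlinarith [sq_nonneg x])
  rw [stdGaussianPDF_eq]
  calc _ ≤ (2 / 5 : ℝ) * 1 := mul_le_mul h2 h3 (exp_pos _).le (by norm_num)
    _ = 2 / 5 := mul_one _

lemma tendsto_stdGaussianPDF_atTop : Filter.Tendsto φ Filter.atTop (nhds 0) := by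
  rw [funext stdGaussianPDF_eq, ← mul_zero (√(2 * π))⁻¹]
  refine Filter.Tendsto.const_mul _ (tendsto_exp_atBot.comp ?_)
  exact Filter.Tendsto.const_mul_atTop_of_neg (by norm_num)
    (Filter.tendsto_pow_atTop two_ne_zero)

lemma tendsto_stdGaussianPDF_atBot : Filter.Tendsto φ Filter.atBot (nhds 0) := by
  refine (tendsto_stdGaussianPDF_atTop.comp Filter.tendsto_neg_atBot_atTop).congr fun x => ?_
  simp [stdGaussianPDF_neg]

lemma integrable_stdGaussianPDF : Integrable φ := integrable_gaussianPDFReal 0 1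

lemma integrable_id_mul_stdGaussianPDF : Integrable fun x => x * φ x := by
  refine ((integrable_mul_exp_neg_mul_sq (b := 1 / 2) (by norm_num)).const_mul
    (√(2 * π))⁻¹).congr (Filter.Eventually.of_forall fun x => ?_)
  simp only [stdGaussianPDF_eq]
  ring

lemma integral_Iic_id_mul_stdGaussianPDF (x : ℝ) : ∫ z in Set.Iic x, z * φ z = -φ x := by
  have := integral_Iic_of_hasDerivAt_of_tendsto' (a := x) (f := fun z => -φ z)
    (f' := fun z => z * φ z) (m := 0)
    (fun z _ => by simpa using (hasDerivAt_stdGaussianPDF z).fun_neg)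
    integrable_id_mul_stdGaussianPDF.integrableOn
    (by simpa using tendsto_stdGaussianPDF_atBot.neg)
  simpa using this

lemma integral_Ioi_id_mul_stdGaussianPDF (x : ℝ) : ∫ z in Set.Ioi x, z * φ z = φ x := by
  have := integral_Ioi_of_hasDerivAt_of_tendsto' (a := x) (f := fun z => -φ z)
    (f' := fun z => z * φ z) (m := 0)
    (fun z _ => by simpa using (hasDerivAt_stdGaussianPDF z).fun_neg)
    integrable_id_mul_stdGaussianPDF.integrableOn
    (by simpa using tendsto_stdGaussianPDF_atTop.neg)
  simpa using this

lemma hasDerivAt_integral_Iic {k : ℝ → ℝ} (hk : Continuous k) (hi : Integrable k) (x : ℝ) :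
    HasDerivAt (fun y => ∫ z in Set.Iic y, k z) (k x) x := by
  have h1 : (fun y => ∫ z in Set.Iic y, k z)
      = fun y => (∫ z in Set.Iic (0 : ℝ), k z) + ∫ z in (0 : ℝ)..y, k z := by
    funext y
    rw [← intervalIntegral.integral_Iic_sub_Iic hi.integrableOn hi.integrableOn]
    ring
  rw [h1]
  exact (intervalIntegral.integral_hasDerivAt_right (hk.intervalIntegrable _ _)
    (hk.stronglyMeasurableAtFilter _ _) hk.continuousAt).const_add _

lemma integral_Iic_add_integral_Ioi_stdGaussianPDF (x : ℝ) :
    (∫ z in Set.Iic x, φ z) + ∫ z in Set.Ioi x, φ z = 1 := by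
  rw [intervalIntegral.integral_Iic_add_Ioi integrable_stdGaussianPDF.integrableOn
    integrable_stdGaussianPDF.integrableOn]
  exact integral_gaussianPDFReal_eq_one 0 one_ne_zero

lemma integral_Iic_eq_integral_Ioi_neg_stdGaussianPDF (x : ℝ) :
    ∫ z in Set.Iic x, φ z = ∫ z in Set.Ioi (-x), φ z := by
  rw [← integral_comp_neg_Iic]
  simp only [stdGaussianPDF_neg]

/-- Birnbaum's lower bound for Mills' ratio. -/
lemma birnbaum_mul_stdGaussianPDF_le (x : ℝ) :
    (√(x ^ 2 + 4) - x) / 2 * φ x ≤ ∫ z in Set.Ioi x, φ z := by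
  have hr : ∀ y : ℝ, 0 < √(y ^ 2 + 4) := fun y => Real.sqrt_pos.2 (by positivity)
  have hsq : ∀ y : ℝ, √(y ^ 2 + 4) ^ 2 = y ^ 2 + 4 := fun y => Real.sq_sqrt (by positivity)
  let D : ℝ → ℝ := fun y => 1 - (∫ z in Set.Iic y, φ z) - (√(y ^ 2 + 4) - y) / 2 * φ y
  have hD : ∀ y, D y = (∫ z in Set.Ioi y, φ z) - (√(y ^ 2 + 4) - y) / 2 * φ y := fun y => by
    simp only [D]
    linarith [integral_Iic_add_integral_Ioi_stdGaussianPDF y]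
  have hderiv : ∀ y, HasDerivAt D
      (-φ y - ((y / √(y ^ 2 + 4) - 1) / 2 * φ y + (√(y ^ 2 + 4) - y) / 2 * -(y * φ y))) y := by
    intro y
    have h1 : HasDerivAt (fun u : ℝ => √(u ^ 2 + 4)) (y / √(y ^ 2 + 4)) y := by
      have h2 : HasDerivAt (fun u : ℝ => u ^ 2 + 4) (2 * y) y := by
        simpa using (hasDerivAt_pow 2 y).add_const (4 : ℝ)
      convert! h2.sqrt (by positivity) using 1
      field_simp
    have h3 := ((h1.sub (hasDerivAt_id y)).div_const 2).mul (hasDerivAt_stdGaussianPDF y)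
    exact ((hasDerivAt_integral_Iic continuous_stdGaussianPDF integrable_stdGaussianPDF
      y).const_sub 1).sub h3
  have hanti : Antitone D := by
    refine antitone_of_hasDerivAt_nonpos hderiv fun y => ?_
    have hφ := stdGaussianPDF_pos y
    have hry := hr y
    have hs := hsq y
    set r := √(y ^ 2 + 4)
    have habs : |y| < r := abs_lt_of_sq_lt_sq (by linarith) hry.le
    have hyr : 0 < r - y := by linarith [le_abs_self y]
    have h1 : y / r * r = y := div_mul_cancel₀ _ hry.ne'
    have h4 : (-1 - (y / r - 1) / 2 + (r - y) / 2 * y) * r ≤ 0 := by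
      have : (-1 - (y / r - 1) / 2 + (r - y) / 2 * y) * r
          = -(r - y) ^ 3 / 8 := by
        have e1 : (-1 - (y / r - 1) / 2 + (r - y) / 2 * y) * r
          = -r / 2 - y / r * r / 2 + (r ^ 2 - y * r) / 2 * y := by ring
        rw [e1, h1, hs]
        linear_combination (r / 8 - 3 * y / 8) * hs
      rw [this]
      have := pow_pos hyr 3
      linarith
    have h5 : -1 - (y / r - 1) / 2 + (r - y) / 2 * y ≤ 0 := by
      by_contra! hc
      exact absurd (mul_pos hc hry) (not_lt.2 h4)
    have := mul_nonpos_of_nonpos_of_nonneg h5 hφ.le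
    simp only [Pi.zero_apply]
    linarith
  have hlim : (0 : ℝ) ≤ D x := by
    have htend : Filter.Tendsto (fun y => -φ y) Filter.atTop (nhds 0) := by
      simpa using tendsto_stdGaussianPDF_atTop.neg
    refine le_of_tendsto htend ?_
    filter_upwards [Filter.eventually_ge_atTop x, Filter.eventually_ge_atTop 0] with y hxy hy
    refine le_trans ?_ (hanti hxy)
    have h1 : 0 ≤ ∫ z in Set.Ioi y, φ z := integral_nonneg fun z => (stdGaussianPDF_pos z).le
    have h2 : √(y ^ 2 + 4) ≤ y + 2 := Real.sqrt_le_iff.2 ⟨by linarith, by nlinarith⟩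
    have h3 : (√(y ^ 2 + 4) - y) / 2 * φ y ≤ 1 * φ y :=
      mul_le_mul_of_nonneg_right (by linarith) (stdGaussianPDF_pos y).le
    rw [hD]
    linarith
  rw [hD] at hlim
  linarith

lemma exists_pos_mul_stdGaussianPDF_le (x : ℝ) :
    ∃ a : ℝ, 0 < a ∧ a ^ 2 + x * a = 1 ∧ a * φ x ≤ ∫ z in Set.Ioi x, φ z := by
  have hs : √(x ^ 2 + 4) ^ 2 = x ^ 2 + 4 := Real.sq_sqrt (by positivity)
  have habs : |x| < √(x ^ 2 + 4) := abs_lt_of_sq_lt_sq (by linarith) (Real.sqrt_nonneg _)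
  refine ⟨(√(x ^ 2 + 4) - x) / 2, ?_, ?_, birnbaum_mul_stdGaussianPDF_le x⟩
  · linarith [le_abs_self x]
  · linear_combination hs / 4

/-- The lower bound `x / (1 + x ^ 2)` for Mills' ratio. -/
lemma id_mul_stdGaussianPDF_le (x : ℝ) :
    x * φ x ≤ (1 + x ^ 2) * ∫ z in Set.Ioi x, φ z := by
  obtain ⟨a, ha, hax, hle⟩ := exists_pos_mul_stdGaussianPDF_le x
  have h1 : x ≤ (1 + x ^ 2) * a := by
    have : (1 + x ^ 2) * a - x = a ^ 3 := by linear_combination (x - a) * hax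
    have := pow_pos ha 3
    linarith
  calc x * φ x ≤ (1 + x ^ 2) * a * φ x :=
        mul_le_mul_of_nonneg_right h1 (stdGaussianPDF_pos x).le
    _ = (1 + x ^ 2) * (a * φ x) := mul_assoc _ _ _
    _ ≤ _ := mul_le_mul_of_nonneg_left hle (by positivity)

/-- `E (x - Y)⁺` for a standard normal `Y`. -/
lemma integral_Iic_sub_mul_stdGaussianPDF (x : ℝ) :
    ∫ z in Set.Iic x, (x - z) * φ z = x * (∫ z in Set.Iic x, φ z) + φ x := by
  simp only [sub_mul]
  rw [integral_sub (integrable_stdGaussianPDF.const_mul x).integrableOn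
    integrable_id_mul_stdGaussianPDF.integrableOn, integral_const_mul,
    integral_Iic_id_mul_stdGaussianPDF]
  ring

/-- `E (Y - x)⁺` for a standard normal `Y`. -/
lemma integral_Ioi_sub_mul_stdGaussianPDF (x : ℝ) :
    ∫ z in Set.Ioi x, (z - x) * φ z = φ x - x * ∫ z in Set.Ioi x, φ z := by
  simp only [sub_mul]
  rw [integral_sub integrable_id_mul_stdGaussianPDF.integrableOn
    (integrable_stdGaussianPDF.const_mul x).integrableOn, integral_const_mul,
    integral_Ioi_id_mul_stdGaussianPDF]

lemma integral_Iic_sub_mul_stdGaussianPDF_nonneg (x : ℝ) :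
    0 ≤ x * (∫ z in Set.Iic x, φ z) + φ x := by
  rw [← integral_Iic_sub_mul_stdGaussianPDF]
  exact setIntegral_nonneg measurableSet_Iic fun z hz =>
    mul_nonneg (sub_nonneg.2 hz) (stdGaussianPDF_pos z).le

lemma integral_Ioi_sub_mul_stdGaussianPDF_nonneg (x : ℝ) :
    0 ≤ φ x - x * ∫ z in Set.Ioi x, φ z := by
  rw [← integral_Ioi_sub_mul_stdGaussianPDF]
  exact setIntegral_nonneg measurableSet_Ioi fun z hz =>
    mul_nonneg (sub_nonneg.2 (le_of_lt hz)) (stdGaussianPDF_pos z).le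

lemma two_mul_partial_moments_le (x : ℝ) :
    2 * ((x * (∫ z in Set.Iic x, φ z) + φ x) * (φ x - x * ∫ z in Set.Ioi x, φ z)) ≤ φ x := by
  wlog hx : 0 ≤ x generalizing x
  · have := this (-x) (by linarith)
    rw [← integral_Iic_eq_integral_Ioi_neg_stdGaussianPDF x,
      integral_Iic_eq_integral_Ioi_neg_stdGaussianPDF (-x), neg_neg, stdGaussianPDF_neg] at this
    linarith
  obtain ⟨a, ha, hax, hle⟩ := exists_pos_mul_stdGaussianPDF_le x
  have hsum := integral_Iic_add_integral_Ioi_stdGaussianPDF x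
  have hQ0 := integral_Ioi_sub_mul_stdGaussianPDF_nonneg x
  have hφ := stdGaussianPDF_pos x
  have hφ' := stdGaussianPDF_le x
  set p := φ x
  set Q := p - x * ∫ z in Set.Ioi x, φ z with hQ
  have hP : x * (∫ z in Set.Iic x, φ z) + p = x + Q := by
    rw [hQ]; linear_combination x * hsum
  rw [hP]
  have ha1 : a ≤ 1 := by nlinarith [mul_nonneg hx ha.le]
  have hQa : Q ≤ a ^ 2 * p := by
    have := mul_le_mul_of_nonneg_left hle hx
    have e : a ^ 2 * p = p - x * (a * p) := by linear_combination p * hax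
    rw [e, hQ]; linarith
  have h1 : (x + Q) * Q ≤ (x + a ^ 2 * p) * (a ^ 2 * p) :=
    mul_le_mul (by linarith) hQa hQ0 (by positivity)
  have h2 : (x + a ^ 2 * p) * (a ^ 2 * p) = p * (a - a ^ 3 + p * a ^ 4) := by
    linear_combination (a * p) * hax
  have h3 : a - a ^ 3 + p * a ^ 4 ≤ 1 / 2 := by
    have h4 : p * a ^ 4 ≤ 2 / 5 * a ^ 4 := mul_le_mul_of_nonneg_right hφ' (by positivity)
    have h5 : a - a ^ 3 + 2 / 5 * a ^ 4 ≤ 1 / 2 := by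
      nlinarith [sq_nonneg (a ^ 2 - 3 / 4 * a), sq_nonneg (a - 3 / 4), sq_nonneg (a ^ 2 - 9 / 16),
        mul_nonneg ha.le (sq_nonneg (a - 3 / 4))]
    linarith
  have := mul_le_mul_of_nonneg_left h3 hφ.le
  linarith

/-- The bounded solution of the Stein equation `g' x - x * g x = h x - E h(Y)`. -/
noncomputable def steinSolution (h : ℝ → ℝ) (x : ℝ) : ℝ :=
  ((∫ z in Set.Iic x, h z * φ z) - (∫ z, h z * φ z) * ∫ z in Set.Iic x, φ z) / φ x

variable {h : ℝ → ℝ} {L : ℝ}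

lemma continuous_of_abs_sub_le (hh : ∀ x y : ℝ, |h x - h y| ≤ L * |x - y|) : Continuous h :=
  (LipschitzWith.of_dist_le' (K := L) fun x y => by
    simpa only [Real.dist_eq] using hh x y).continuous

lemma integrable_mul_stdGaussianPDF (hh : ∀ x y : ℝ, |h x - h y| ≤ L * |x - y|) :
    Integrable fun z => h z * φ z := by
  refine Integrable.mono' ((integrable_stdGaussianPDF.const_mul |h 0|).add
    (integrable_id_mul_stdGaussianPDF.norm.const_mul L))
    ((continuous_of_abs_sub_le hh).mul continuous_stdGaussianPDF).aestronglyMeasurable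
    (Filter.Eventually.of_forall fun z => ?_)
  have hφ := stdGaussianPDF_pos z
  have h1 := hh z 0
  have h2 : |h z| ≤ |h 0| + L * |z| := by
    have := abs_sub_abs_le_abs_sub (h z) (h 0)
    rw [sub_zero] at h1
    linarith
  simp only [Pi.add_apply, norm_mul, Real.norm_eq_abs, abs_of_pos hφ]
  calc |h z| * φ z ≤ (|h 0| + L * |z|) * φ z := mul_le_mul_of_nonneg_right h2 hφ.le
    _ = _ := by ring

lemma hasDerivAt_steinSolution (hh : ∀ x y : ℝ, |h x - h y| ≤ L * |x - y|) (x : ℝ) :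
    HasDerivAt (steinSolution h)
      (x * steinSolution h x + (h x - ∫ z, h z * φ z)) x := by
  have hφ := (stdGaussianPDF_pos x).ne'
  have h1 := hasDerivAt_integral_Iic (k := fun z => h z * φ z)
    ((continuous_of_abs_sub_le hh).mul continuous_stdGaussianPDF)
    (integrable_mul_stdGaussianPDF hh) x
  have h2 := hasDerivAt_integral_Iic continuous_stdGaussianPDF integrable_stdGaussianPDF x
  convert! (h1.sub (h2.const_mul (∫ z, h z * φ z))).div (hasDerivAt_stdGaussianPDF x) hφ using 1
  simp only [steinSolution, Pi.sub_apply]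
  field_simp
  ring

/-- The one-sided centred integrals of an `L`-Lipschitz function: bounds on them, and the Stein
solution in terms of them. -/
lemma exists_steinSolution_decomposition (hh : ∀ x y : ℝ, |h x - h y| ≤ L * |x - y|) (x : ℝ) :
    ∃ A B : ℝ, |A| ≤ L * (x * (∫ z in Set.Iic x, φ z) + φ x) ∧
      |B| ≤ L * (φ x - x * ∫ z in Set.Ioi x, φ z) ∧
      h x - (∫ z, h z * φ z) = -(A + B) ∧
      steinSolution h x * φ x = A * (∫ z in Set.Ioi x, φ z) - B * ∫ z in Set.Iic x, φ z := by
  have hi := integrable_mul_stdGaussianPDF hh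
  have hsum := integral_Iic_add_integral_Ioi_stdGaussianPDF x
  have hcentred : ∀ s : Set ℝ, ∫ z in s, (h z - h x) * φ z
      = (∫ z in s, h z * φ z) - h x * ∫ z in s, φ z := fun s => by
    simp only [sub_mul]
    rw [integral_sub hi.integrableOn (integrable_stdGaussianPDF.const_mul _).integrableOn,
      integral_const_mul]
  have hmean := intervalIntegral.integral_Iic_add_Ioi (b := x) hi.integrableOn hi.integrableOn
  have hxint : Integrable fun z => (z - x) * φ z := by
    simp only [sub_mul]
    exact integrable_id_mul_stdGaussianPDF.sub (integrable_stdGaussianPDF.const_mul _)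
  have hxint' : Integrable fun z => (x - z) * φ z := by
    simp only [sub_mul]
    exact (integrable_stdGaussianPDF.const_mul _).sub integrable_id_mul_stdGaussianPDF
  have hpt : ∀ z, ‖(h z - h x) * φ z‖ ≤ L * (|z - x| * φ z) := fun z => by
    rw [norm_mul, Real.norm_eq_abs, Real.norm_eq_abs, abs_of_pos (stdGaussianPDF_pos z),
      ← mul_assoc]
    exact mul_le_mul_of_nonneg_right (hh z x) (stdGaussianPDF_pos z).le
  refine ⟨∫ z in Set.Iic x, (h z - h x) * φ z, ∫ z in Set.Ioi x, (h z - h x) * φ z,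
    ?_, ?_, ?_, ?_⟩
  · rw [← integral_Iic_sub_mul_stdGaussianPDF, ← integral_const_mul, ← Real.norm_eq_abs]
    refine norm_integral_le_of_norm_le (hxint'.const_mul L).integrableOn ?_
    filter_upwards [ae_restrict_mem measurableSet_Iic] with z hz
    have := hpt z
    rwa [abs_sub_comm, abs_of_nonneg (sub_nonneg.2 hz)] at this
  · rw [← integral_Ioi_sub_mul_stdGaussianPDF, ← integral_const_mul, ← Real.norm_eq_abs]
    refine norm_integral_le_of_norm_le (hxint.const_mul L).integrableOn ?_
    filter_upwards [ae_restrict_mem measurableSet_Ioi] with z hz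
    have := hpt z
    rwa [abs_of_nonneg (sub_nonneg.2 (le_of_lt hz))] at this
  · rw [hcentred, hcentred, ← hmean]
    linear_combination (-h x) * hsum
  · rw [hcentred, hcentred, steinSolution, div_mul_cancel₀ _ (stdGaussianPDF_pos x).ne', ← hmean]
    linear_combination (-(∫ z in Set.Iic x, h z * φ z)) * hsum

lemma nonneg_of_abs_sub_le (hh : ∀ x y : ℝ, |h x - h y| ≤ L * |x - y|) : 0 ≤ L := by
  have := (abs_nonneg _).trans (hh 1 0)
  simpa using this

lemma abs_deriv_steinSolution_le (hh : ∀ x y : ℝ, |h x - h y| ≤ L * |x - y|) (x : ℝ) :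
    |x * steinSolution h x + (h x - ∫ z, h z * φ z)| ≤ L := by
  obtain ⟨A, B, hA, hB, hAB, hg⟩ := exists_steinSolution_decomposition hh x
  have hL := nonneg_of_abs_sub_le hh
  have hφ := stdGaussianPDF_pos x
  have hP := integral_Iic_sub_mul_stdGaussianPDF_nonneg x
  have hQ := integral_Ioi_sub_mul_stdGaussianPDF_nonneg x
  have hPQ := two_mul_partial_moments_le x
  rw [hAB]
  set P := x * (∫ z in Set.Iic x, φ z) + φ x
  set Q := φ x - x * ∫ z in Set.Ioi x, φ z
  have key : (x * steinSolution h x + -(A + B)) * φ x = -(A * Q + B * P) := by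
    linear_combination x * hg
  refine le_of_mul_le_mul_right ?_ hφ
  rw [← abs_of_pos hφ, ← abs_mul, abs_of_pos hφ, key, abs_neg]
  calc |A * Q + B * P| ≤ |A| * Q + |B| * P := by
        refine (abs_add_le _ _).trans ?_
        rw [abs_mul, abs_mul, abs_of_nonneg hP, abs_of_nonneg hQ]
    _ ≤ L * P * Q + L * Q * P := by gcongr
    _ = L * (2 * (P * Q)) := by ring
    _ ≤ L * φ x := by gcongr

lemma abs_deriv_id_mul_steinSolution_le (hh : ∀ x y : ℝ, |h x - h y| ≤ L * |x - y|) (x : ℝ) :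
    |steinSolution h x + x * (x * steinSolution h x + (h x - ∫ z, h z * φ z))| ≤ L := by
  obtain ⟨A, B, hA, hB, hAB, hg⟩ := exists_steinSolution_decomposition hh x
  have hφ := stdGaussianPDF_pos x
  have hsum := integral_Iic_add_integral_Ioi_stdGaussianPDF x
  have hM := id_mul_stdGaussianPDF_le x
  have hM' := id_mul_stdGaussianPDF_le (-x)
  rw [← integral_Iic_eq_integral_Ioi_neg_stdGaussianPDF, stdGaussianPDF_neg, neg_sq] at hM'
  rw [hAB]
  set F := ∫ z in Set.Iic x, φ z
  set G := ∫ z in Set.Ioi x, φ z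
  have key : (steinSolution h x + x * (x * steinSolution h x + -(A + B))) * φ x
      = A * ((1 + x ^ 2) * G - x * φ x) - B * ((1 + x ^ 2) * F + x * φ x) := by
    linear_combination (1 + x ^ 2) * hg
  have hu : 0 ≤ (1 + x ^ 2) * G - x * φ x := by linarith
  have hv : 0 ≤ (1 + x ^ 2) * F + x * φ x := by linarith
  refine le_of_mul_le_mul_right ?_ hφ
  rw [← abs_of_pos hφ, ← abs_mul, abs_of_pos hφ, key]
  calc _ ≤ |A| * ((1 + x ^ 2) * G - x * φ x) + |B| * ((1 + x ^ 2) * F + x * φ x) := by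
        refine (abs_sub _ _).trans ?_
        rw [abs_mul, abs_mul, abs_of_nonneg hu, abs_of_nonneg hv]
    _ ≤ L * (x * F + φ x) * ((1 + x ^ 2) * G - x * φ x)
        + L * (φ x - x * G) * ((1 + x ^ 2) * F + x * φ x) := by gcongr
    _ = L * φ x := by linear_combination (L * φ x) * hsum

lemma abs_sub_deriv_steinSolution_le (hh : ∀ x y : ℝ, |h x - h y| ≤ L * |x - y|) (x y : ℝ) :
    |(x * steinSolution h x + (h x - ∫ z, h z * φ z))
      - (y * steinSolution h y + (h y - ∫ z, h z * φ z))| ≤ 2 * L * |x - y| := by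
  have h1 : |x * steinSolution h x - y * steinSolution h y| ≤ L * |x - y| := by
    refine convex_univ.norm_image_sub_le_of_norm_hasDerivWithin_le
      (f := fun u => u * steinSolution h u)
      (f' := fun u => steinSolution h u + u * (u * steinSolution h u + (h u - ∫ z, h z * φ z)))
      (fun u _ => ?_) (fun u _ => abs_deriv_id_mul_steinSolution_le hh u)
      (Set.mem_univ y) (Set.mem_univ x)
    simpa using ((hasDerivAt_id' u).fun_mul
      (hasDerivAt_steinSolution hh u)).hasDerivWithinAt (s := Set.univ)
  have e : (x * steinSolution h x + (h x - ∫ z, h z * φ z))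
      - (y * steinSolution h y + (h y - ∫ z, h z * φ z))
      = (x * steinSolution h x - y * steinSolution h y) + (h x - h y) := by ring
  rw [e]
  refine (abs_add_le _ _).trans ?_
  linarith [hh x y]

end Density

/-- Scaled Stein equation (display (10)–(11) in Röllin): for an `L`-Lipschitz `h`, `s ∈ ℝ` and
`t > 0`, there is a differentiable `f = f_{s,t}` with
`t² f'(w) − (w − s) f(w) = h(w) − E h(tY + s)` for `Y ~ N(0,1)`, with `‖f'‖ ≤ L/t` and
`f'` Lipschitz with constant `2L/t²`. -/
theorem scaled_stein_equation_solution
    (h : ℝ → ℝ) (L : ℝ)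
    (hh : ∀ x y : ℝ, |h x - h y| ≤ L * |x - y|)
    (s t : ℝ) (ht : 0 < t) :
    ∃ f : ℝ → ℝ, Differentiable ℝ f ∧
      (∀ w : ℝ, t ^ 2 * deriv f w - (w - s) * f w
          = h w - ∫ y, h (t * y + s) ∂(gaussianReal 0 1)) ∧
      (∀ w : ℝ, |deriv f w| ≤ L / t) ∧
      (∀ x y : ℝ, |deriv f x - deriv f y| ≤ (2 * L / t ^ 2) * |x - y|) := by
  have hH : ∀ x y : ℝ, |h (t * x + s) / t - h (t * y + s) / t| ≤ L * |x - y| := by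
    intro x y
    rw [← sub_div, abs_div, abs_of_pos ht, div_le_iff₀ ht]
    refine (hh _ _).trans_eq ?_
    rw [show t * x + s - (t * y + s) = t * (x - y) by ring, abs_mul, abs_of_pos ht]
    ring
  set H : ℝ → ℝ := fun x => h (t * x + s) / t with hHdef
  have hmean : ∫ y, h (t * y + s) ∂(gaussianReal 0 1)
      = t * ∫ z, H z * gaussianPDFReal 0 1 z := by
    rw [integral_gaussianReal_eq_integral_smul one_ne_zero, ← integral_const_mul]
    refine integral_congr_ae (Filter.Eventually.of_forall fun z => ?_)
    simp only [hHdef, smul_eq_mul]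
    field_simp
  let G : ℝ → ℝ := fun x => x * steinSolution H x + (H x - ∫ z, H z * gaussianPDFReal 0 1 z)
  have hderiv : ∀ w, HasDerivAt (fun w => steinSolution H ((w - s) / t))
      (G ((w - s) / t) / t) w := by
    intro w
    have h1 : HasDerivAt (fun w : ℝ => (w - s) / t) (1 / t) w :=
      ((hasDerivAt_id w).sub_const s).div_const t
    convert! (hasDerivAt_steinSolution hH ((w - s) / t)).comp w h1 using 1
    simp only [G]
    ring
  refine ⟨fun w => steinSolution H ((w - s) / t), fun w => (hderiv w).differentiableAt,
    fun w => ?_, fun w => ?_, fun x y => ?_⟩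
  · rw [(hderiv w).deriv, hmean]
    have hw : H ((w - s) / t) = h w / t := by
      simp only [hHdef]
      rw [mul_div_cancel₀ _ ht.ne', sub_add_cancel]
    simp only [G, hw]
    field_simp
    ring
  · rw [(hderiv w).deriv, abs_div, abs_of_pos ht]
    exact div_le_div_of_nonneg_right (abs_deriv_steinSolution_le hH _) ht.le
  · rw [(hderiv x).deriv, (hderiv y).deriv, ← sub_div, abs_div, abs_of_pos ht, div_le_iff₀ ht]
    refine (abs_sub_deriv_steinSolution_le hH _ _).trans_eq ?_
    rw [← sub_div, sub_sub_sub_cancel_right, abs_div, abs_of_pos ht]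
    field_simp
end
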